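/- arXiv:2302.08354 — 8 statements merged into one kernel-verified Lean document; each statement's English description precedes it below -/
import Mathlib

section
/- Let E be a finite-dimensional real inner product space, L > 0, λ ≥ 0, and let A : E → E be a symmetric (self-adjoint) linear map with operator norm ‖A‖ < (2π/L)². If V : ℝ → E is a twice continuously differentiable L-periodic function satisfying V''(t) + A(V(t)) = λ·V(t) for all t ∈ ℝ, then V is constant, and its constant value v satisfies A(v) = λ·v. -/
open scoped RealInnerProductSpace

theorem aux_exp (g : ℝ → ℂ) (s : ℂ) (hg : ∀ t, HasDerivAt g (s * g t) t) (t : ℝ) :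
    g t = g 0 * Complex.exp (s * t) := by
  have hE : ∀ t : ℝ, HasDerivAt (fun t : ℝ => Complex.exp (-(s * t)))
      (Complex.exp (-(s * t)) * (-(s * 1))) t := by
    intro t
    exact (((hasDerivAt_id (t : ℂ)).const_mul s).neg.cexp).comp_ofReal
  have h : ∀ t : ℝ, HasDerivAt (fun t : ℝ => g t * Complex.exp (-(s * t))) 0 t := by
    intro t
    have := (hg t).mul (hE t)
    exact this.congr_deriv (by ring)
  have hc := is_const_of_deriv_eq_zero (fun t => (h t).differentiableAt)
    (fun t => (h t).deriv) t 0
  simp only [Complex.ofReal_zero, mul_zero, neg_zero, Complex.exp_zero, mul_one] at hc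
  rw [← hc, mul_assoc, ← Complex.exp_add]
  simp

theorem aux_zero (g : ℝ → ℂ) (s : ℂ) (L : ℝ) (hg : ∀ t, HasDerivAt g (s * g t) t)
    (hL : g L = g 0) (hs : Complex.exp (s * L) ≠ 1) (t : ℝ) : g t = 0 := by
  have h1 := aux_exp g s hg L
  have h0 : g 0 = 0 := by
    have : g 0 * (Complex.exp (s * L) - 1) = 0 := by rw [mul_sub, ← h1, hL]; ring
    rcases mul_eq_zero.1 this with h | h
    · exact h
    · exact absurd (sub_eq_zero.1 h) hs
  rw [aux_exp g s hg t, h0, zero_mul]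

theorem aux_ne_one (L c : ℝ) (hL : 0 < L) (hc : -(2 * Real.pi / L) ^ 2 < c) (hc0 : c ≠ 0)
    (s : ℂ) (hs : s * s = c) : Complex.exp (s * L) ≠ 1 := by
  intro h
  obtain ⟨n, hn⟩ := Complex.exp_eq_one_iff.1 h
  have h2 : ((c * L ^ 2 : ℝ) : ℂ) = ((-(n * (2 * Real.pi)) ^ 2 : ℝ) : ℂ) := by
    push_cast
    rw [← hs]
    calc s * s * (L : ℂ) ^ 2 = (s * L) ^ 2 := by ring
      _ = (n * (2 * Real.pi)) ^ 2 * Complex.I ^ 2 := by rw [hn]; ring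
      _ = _ := by rw [Complex.I_sq]; ring
  have h3 : c * L ^ 2 = -(n * (2 * Real.pi)) ^ 2 := by exact_mod_cast h2
  have hn0 : n ≠ 0 := by
    rintro rfl
    simp [hc0, hL.ne'] at h3
  have hn1 : (1 : ℝ) ≤ (n : ℝ) ^ 2 := by
    have : 1 ≤ n ^ 2 := by have := sq_pos_of_ne_zero hn0; lia
    exact_mod_cast this
  have h4 : -(2 * Real.pi) ^ 2 < c * L ^ 2 := by
    have := mul_lt_mul_of_pos_right hc (pow_pos hL 2)
    have e : -(2 * Real.pi / L) ^ 2 * L ^ 2 = -(2 * Real.pi) ^ 2 := by field_simp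
    linarith
  nlinarith [Real.pi_pos, sq_nonneg (2 * Real.pi)]

theorem aux_scalar (L c : ℝ) (hL : 0 < L) (hc : -(2 * Real.pi / L) ^ 2 < c)
    (F G : ℝ → ℂ) (hF : ∀ t, HasDerivAt F (G t) t) (hG : ∀ t, HasDerivAt G (c * F t) t)
    (pF : F L = F 0) (pG : G L = G 0) (t : ℝ) : F t = F 0 := by
  by_cases hc0 : c = 0
  · subst hc0
    have hGc : ∀ t, G t = G 0 := fun t => is_const_of_deriv_eq_zero
      (fun t => (hG t).differentiableAt) (fun t => by rw [(hG t).deriv]; simp) t 0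
    have h : ∀ t : ℝ, HasDerivAt (fun t : ℝ => F t - G 0 * t) 0 t := by
      intro t
      have := (hF t).sub ((hasDerivAt_id (t : ℂ)).const_mul (G 0)).comp_ofReal
      exact this.congr_deriv (by rw [hGc t]; simp)
    have hk := fun t => is_const_of_deriv_eq_zero (fun t => (h t).differentiableAt)
      (fun t => (h t).deriv) t 0
    have hkL := hk L
    have hkt := hk t
    simp only [pF, Complex.ofReal_zero, mul_zero, sub_zero, sub_eq_self, mul_eq_zero,
      Complex.ofReal_eq_zero, hL.ne', or_false] at hkL
    simpa [hkL] using hkt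
  · obtain ⟨s, hs⟩ := IsAlgClosed.exists_pow_nat_eq (c : ℂ) (n := 2) (by norm_num)
    have hs2 : s * s = c := by rw [← hs]; ring
    have hs0 : s ≠ 0 := by
      rintro rfl
      rw [mul_zero] at hs2
      exact hc0 (by exact_mod_cast hs2.symm)
    have key : ∀ r : ℂ, r * r = c → ∀ t, G t + r * F t = 0 := by
      intro r hr t
      refine aux_zero (fun t => G t + r * F t) r L ?_ ?_ (aux_ne_one L c hL hc hc0 r hr) t
      · intro t
        have := (hG t).add ((hF t).const_mul r)
        exact this.congr_deriv (by rw [← hr]; ring)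
      · simp only [pF, pG]
    have hz : ∀ t, F t = 0 := by
      intro t
      have h1 := key s hs2 t
      have h2 := key (-s) (by rw [← hs2]; ring) t
      have : s * F t = 0 := by linear_combination (h1 - h2) / 2
      exact (mul_eq_zero.1 this).resolve_left hs0
    rw [hz, hz]

/-- A twice continuously differentiable `L`-periodic solution of
`V'' + A V = λ V`, where `A` is a symmetric operator with `‖A‖ < (2π/L)²`
and `λ ≥ 0`, is constant, and its value is an eigenvector of `A` with
eigenvalue `λ`. -/
theorem periodic_solution_constant
    {E : Type*} [NormedAddCommGroup E] [InnerProductSpace ℝ E]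
    [FiniteDimensional ℝ E]
    (L lam : ℝ) (hL : 0 < L) (hlam : 0 ≤ lam)
    (A : E →L[ℝ] E) (hsym : ∀ x y : E, ⟪A x, y⟫ = ⟪x, A y⟫)
    (hA : ‖A‖ < (2 * Real.pi / L) ^ 2)
    (V : ℝ → E) (hV : ContDiff ℝ 2 V)
    (hper : ∀ t : ℝ, V (t + L) = V t)
    (heq : ∀ t : ℝ, iteratedDeriv 2 V t + A (V t) = lam • V t) :
    (∀ t : ℝ, V t = V 0) ∧ A (V 0) = lam • V 0 := by
  have hd1 : Differentiable ℝ V := hV.differentiable (by norm_num)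
  have hdd : Differentiable ℝ (deriv V) := by
    have := hV.differentiable_iteratedDeriv 1 (by norm_num)
    rwa [iteratedDeriv_one] at this
  have h1 : ∀ t, HasDerivAt V (deriv V t) t := fun t => (hd1 t).hasDerivAt
  have e2 : ∀ t, iteratedDeriv 2 V t = deriv (deriv V) t := by
    intro t
    rw [iteratedDeriv_succ, iteratedDeriv_one]
  have h2 : ∀ t, HasDerivAt (deriv V) (lam • V t - A (V t)) t := by
    intro t
    rw [← heq t, add_sub_cancel_right, e2]
    exact (hdd t).hasDerivAt
  have hpd : deriv V L = deriv V 0 := by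
    have h : (fun t => V (t + L)) = V := funext hper
    have h' := deriv_comp_add_const V L 0
    rw [h, zero_add] at h'
    exact h'.symm
  have hpV : V L = V 0 := by simpa using hper 0
  have hS : (A : E →ₗ[ℝ] E).IsSymmetric := fun x y => hsym x y
  have hconst : ∀ t : ℝ, V t = V 0 := by
    intro t
    let b := hS.eigenvectorBasis (n := Module.finrank ℝ E) rfl
    apply b.repr.injective
    ext i
    rw [b.repr_apply_apply, b.repr_apply_apply]
    set μ : ℝ := hS.eigenvalues rfl i with hμ
    have hb : A (b i) = μ • b i := hS.apply_eigenvectorBasis rfl i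
    have hbn : ‖b i‖ = 1 := b.orthonormal.1 i
    have hμA : |μ| ≤ ‖A‖ := by
      have := A.le_opNorm (b i)
      rwa [hb, norm_smul, hbn, mul_one, mul_one, Real.norm_eq_abs] at this
    have hc : -(2 * Real.pi / L) ^ 2 < lam - μ := by
      have := le_abs_self μ
      linarith
    have hF : ∀ t, HasDerivAt (fun t => ((⟪b i, V t⟫ : ℝ) : ℂ)) ((⟪b i, deriv V t⟫ : ℝ) : ℂ) t := by
      intro t
      have := (hasDerivAt_const t (b i)).inner ℝ (h1 t)
      simpa using this.ofReal_comp
    have hG : ∀ t, HasDerivAt (fun t => ((⟪b i, deriv V t⟫ : ℝ) : ℂ))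
        (((lam - μ : ℝ) : ℂ) * ((⟪b i, V t⟫ : ℝ) : ℂ)) t := by
      intro t
      have h3 := (hasDerivAt_const t (b i)).inner ℝ (h2 t)
      have h4 : (⟪b i, lam • V t - A (V t)⟫ : ℝ) + ⟪(0 : E), deriv V t⟫
          = (lam - μ) * ⟪b i, V t⟫ := by
        rw [inner_sub_right, ← hsym, hb, inner_smul_left, inner_smul_right, inner_zero_left]
        simp
        ring
      rw [h4] at h3
      have h5 := h3.ofReal_comp
      rwa [Complex.ofReal_mul] at h5
    have := aux_scalar L (lam - μ) hL hc _ _ hF hG (by simp only [hpV]) (by simp only [hpd]) t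
    exact_mod_cast this
  refine ⟨hconst, ?_⟩
  have hV0 : V = fun _ => V 0 := funext hconst
  have h0 := heq 0
  have hz : iteratedDeriv 2 V 0 = 0 := by
    rw [e2, hV0]
    simp
  rwa [hz, zero_add] at h0
end

section
/- Let S ⊂ ℝ³ be a finite set of points with 0 ∉ S, let m ≥ 0, and define φ : ℝ³ \ S → ℝ by φ(x) = m + Σ_{P ∈ S} 1/(2‖x − P‖). Let G be a subgroup of the orthogonal group O(3) such that g(S) = S for every g ∈ G (hence φ ∘ g = φ for all g ∈ G). Suppose that the only symmetric bilinear form B : ℝ³ × ℝ³ → ℝ with zero trace (Σᵢ B(eᵢ,eᵢ) = 0) that is G-invariant (B(gx, gy) = B(x,y) for all g ∈ G and all x, y) is B = 0. If the derivative of φ vanishes at the origin, then the full second derivative (Hessian) of φ at the origin also vanishes. -/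
lemma aux_inv_norm (x : EuclideanSpace ℝ (Fin 3)) (hx : x ≠ 0) :
    HasFDerivAt (fun y : EuclideanSpace ℝ (Fin 3) => ‖y‖⁻¹)
      ((-(‖x‖⁻¹) ^ 3) • innerSL ℝ x) x := by
  have hn : ‖x‖ ≠ 0 := norm_ne_zero_iff.mpr hx
  have h1 : HasFDerivAt (fun y : EuclideanSpace ℝ (Fin 3) => ‖y‖ ^ 2) (2 • innerSL ℝ x) x :=
    (hasStrictFDerivAt_norm_sq x).hasFDerivAt
  have h2 := h1.sqrt (pow_ne_zero 2 hn)
  have h3 : HasDerivAt (fun t : ℝ => t⁻¹) (-(‖x‖ ^ 2)⁻¹) (Real.sqrt (‖x‖ ^ 2)) := by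
    have := hasDerivAt_inv (x := Real.sqrt (‖x‖ ^ 2)) (by simpa using hx)
    simpa using this
  have h4 := h3.comp_hasFDerivAt x h2
  have e : ((fun t : ℝ => t⁻¹) ∘ fun y : EuclideanSpace ℝ (Fin 3) => Real.sqrt (‖y‖ ^ 2))
      = fun y => ‖y‖⁻¹ := by
    funext y; simp
  rw [e] at h4
  refine h4.congr_fderiv ?_
  ext v
  simp
  field_simp

lemma aux_shift (P x : EuclideanSpace ℝ (Fin 3)) (hx : x - P ≠ 0) :
    HasFDerivAt (fun y : EuclideanSpace ℝ (Fin 3) => ‖y - P‖⁻¹)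
      ((-(‖x - P‖⁻¹) ^ 3) • innerSL ℝ (x - P)) x := by
  have := (aux_inv_norm (x - P) hx).comp x ((hasFDerivAt_id x).sub_const P)
  simpa [Function.comp_def] using this

/-- The explicit first derivative of one summand. -/
noncomputable def auxD (P x : EuclideanSpace ℝ (Fin 3)) : EuclideanSpace ℝ (Fin 3) →L[ℝ] ℝ :=
  (-(1 / 2) * (‖x - P‖⁻¹) ^ 3) • innerSL ℝ (x - P)

lemma aux_first (P x : EuclideanSpace ℝ (Fin 3)) (hx : x - P ≠ 0) :
    HasFDerivAt (fun y : EuclideanSpace ℝ (Fin 3) => 1 / (2 * ‖y - P‖)) (auxD P x) x := by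
  have h := (aux_shift P x hx).const_mul (1 / 2)
  have e : (fun y : EuclideanSpace ℝ (Fin 3) => 1 / (2 * ‖y - P‖))
      = fun y => 1 / 2 * ‖y - P‖⁻¹ := by
    funext y; simp [mul_comm]
  rw [e]
  refine h.congr_fderiv ?_
  ext v
  simp [auxD]
  try ring

lemma aux_second (P : EuclideanSpace ℝ (Fin 3)) (hP : P ≠ 0) :
    ∃ L : EuclideanSpace ℝ (Fin 3) →L[ℝ] EuclideanSpace ℝ (Fin 3) →L[ℝ] ℝ,
      HasFDerivAt (auxD P) L 0 ∧ ∀ u v, L u v =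
        -(1 / 2) * (‖P‖⁻¹) ^ 3 * inner ℝ u v
          + 3 / 2 * (‖P‖⁻¹) ^ 5 * (inner ℝ P u * inner ℝ P v) := by
  have h0 : (0 : EuclideanSpace ℝ (Fin 3)) - P ≠ 0 := by simpa using hP
  have h1 := ((aux_shift P 0 h0).pow 3).const_mul (-(1 / 2))
  have h2 : HasFDerivAt (fun x : EuclideanSpace ℝ (Fin 3) => innerSL ℝ (x - P))
      (innerSL ℝ : EuclideanSpace ℝ (Fin 3) →L[ℝ] EuclideanSpace ℝ (Fin 3) →L[ℝ] ℝ) 0 := by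
    have := ((innerSL ℝ : EuclideanSpace ℝ (Fin 3) →L[ℝ] EuclideanSpace ℝ (Fin 3) →L[ℝ] ℝ).hasFDerivAt
      (x := 0 - P)).comp 0 ((hasFDerivAt_id (0 : EuclideanSpace ℝ (Fin 3))).sub_const P)
    simpa [Function.comp_def] using this
  refine ⟨_, h1.smul h2, ?_⟩
  intro u v
  have huv : ((innerSL ℝ : EuclideanSpace ℝ (Fin 3) →L[ℝ] EuclideanSpace ℝ (Fin 3) →L[ℝ] ℝ) u) v
      = inner ℝ u v := rfl
  rw [← huv]
  simp only [ContinuousLinearMap.add_apply, ContinuousLinearMap.smul_apply]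
  simp
  ring_nf
  try rfl

theorem hessian_vanishes_of_symmetry
    (S : Finset (EuclideanSpace ℝ (Fin 3)))
    (hS : (0 : EuclideanSpace ℝ (Fin 3)) ∉ S)
    (m : ℝ) (hm : 0 ≤ m)
    (phi : EuclideanSpace ℝ (Fin 3) → ℝ)
    (hphi : phi = fun x => m + ∑ P ∈ S, 1 / (2 * ‖x - P‖))
    (G : Subgroup (EuclideanSpace ℝ (Fin 3) ≃ₗᵢ[ℝ] EuclideanSpace ℝ (Fin 3)))
    (hGS : ∀ g ∈ G, (fun x => g x) '' (S : Set (EuclideanSpace ℝ (Fin 3))) = S)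
    (hG : ∀ B : EuclideanSpace ℝ (Fin 3) →ₗ[ℝ] EuclideanSpace ℝ (Fin 3) →ₗ[ℝ] ℝ,
      (∀ x y, B x y = B y x) →
      (∑ i : Fin 3, B (EuclideanSpace.single i 1) (EuclideanSpace.single i 1)) = 0 →
      (∀ g ∈ G, ∀ x y, B (g x) (g y) = B x y) →
      B = 0)
    (hcrit : fderiv ℝ phi 0 = 0) :
    iteratedFDeriv ℝ 2 phi 0 = 0 := by
  have hne : ∀ P ∈ S, P ≠ 0 := fun P hP h => hS (h ▸ hP)
  have hev : fderiv ℝ phi =ᶠ[nhds 0] fun x => ∑ P ∈ S, auxD P x := by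
    have hall : ∀ᶠ x in nhds (0 : EuclideanSpace ℝ (Fin 3)), x ∉ (S : Set _) :=
      S.finite_toSet.isClosed.isOpen_compl.mem_nhds hS
    filter_upwards [hall] with x hx
    rw [hphi]
    refine HasFDerivAt.fderiv (HasFDerivAt.const_add m ?_)
    refine HasFDerivAt.fun_sum fun P hP => aux_first P x ?_
    intro h
    exact hx (by rw [sub_eq_zero.mp h]; exact hP)
  choose! L hL1 hL2 using fun P (hP : P ∈ S) => aux_second P (hne P hP)
  have hd : fderiv ℝ (fderiv ℝ phi) 0 = ∑ P ∈ S, L P := by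
    rw [hev.fderiv_eq]
    exact (HasFDerivAt.fun_sum fun P hP => hL1 P hP).fderiv
  have hval : ∀ u v, fderiv ℝ (fderiv ℝ phi) 0 u v = ∑ P ∈ S,
      (-(1 / 2) * (‖P‖⁻¹) ^ 3 * inner ℝ u v
          + 3 / 2 * (‖P‖⁻¹) ^ 5 * (inner ℝ P u * inner ℝ P v)) := by
    intro u v
    rw [hd]
    simp only [ContinuousLinearMap.sum_apply]
    exact Finset.sum_congr rfl fun P hP => hL2 P hP u v
  let B : EuclideanSpace ℝ (Fin 3) →ₗ[ℝ] EuclideanSpace ℝ (Fin 3) →ₗ[ℝ] ℝ :=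
    LinearMap.mk₂ ℝ (fun u v => fderiv ℝ (fderiv ℝ phi) 0 u v)
      (by intros; simp) (by intros; simp) (by intros; simp) (by intros; simp)
  have hBv : ∀ u v, B u v = fderiv ℝ (fderiv ℝ phi) 0 u v := fun u v => rfl
  have hB : B = 0 := by
    apply hG
    · intro x y
      rw [hBv, hBv, hval, hval]
      refine Finset.sum_congr rfl fun P _ => ?_
      rw [real_inner_comm x y]
      ring
    · simp only [hBv, hval]
      rw [Finset.sum_comm]
      refine Finset.sum_eq_zero fun P hP => ?_
      have hn : ‖P‖ ≠ 0 := norm_ne_zero_iff.mpr (hne P hP)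
      have h2 : ‖P‖ ^ 2 = P 0 ^ 2 + P 1 ^ 2 + P 2 ^ 2 := by
        rw [EuclideanSpace.real_norm_sq_eq, Fin.sum_univ_three]
      simp [Fin.sum_univ_three, EuclideanSpace.inner_single_right]
      field_simp
      rw [h2]
      ring
    · intro g hg x y
      rw [hBv, hBv, hval, hval]
      symm
      refine Finset.sum_bij (fun P _ => g P) ?_ ?_ ?_ ?_
      · intro P hP
        have : g P ∈ (S : Set (EuclideanSpace ℝ (Fin 3))) := by
          rw [← hGS g hg]; exact ⟨P, hP, rfl⟩
        exact this
      · intro a _ b _ h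
        exact g.injective h
      · intro b hb
        have : b ∈ (fun x => g x) '' (S : Set (EuclideanSpace ℝ (Fin 3))) := by
          rw [hGS g hg]; exact hb
        obtain ⟨a, ha, rfl⟩ := this
        exact ⟨a, ha, rfl⟩
      · intro P _
        simp only [LinearIsometryEquiv.norm_map, LinearIsometryEquiv.inner_map_map]
  ext v
  rw [iteratedFDeriv_two_apply, ← hBv, hB]
  simp
end

section
/- Let e₁, e₂, e₃ be the standard basis vectors of ℝ³ and define φ : ℝ³ \ {±e₁, ±e₂, ±e₃} → ℝ by φ(x) = Σ_{i=1}^{3} ( 1/(2‖x − eᵢ‖) + 1/(2‖x + eᵢ‖) ). Then the derivative of φ at the origin vanishes, the full second derivative (Hessian) of φ at the origin vanishes, and 0 is not a local maximum of φ. -/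
abbrev OctE := EuclideanSpace ℝ (Fin 3)

lemma oct_norm_inv (a x : OctE) (h : x ≠ a) :
    HasFDerivAt (fun y : OctE => ‖y - a‖⁻¹) (-(‖x - a‖⁻¹ ^ 3) • innerSL ℝ (x - a)) x := by
  have hn : ‖x - a‖ ≠ 0 := norm_ne_zero_iff.2 (sub_ne_zero.2 h)
  have h1 : HasFDerivAt (fun y : OctE => y - a) (ContinuousLinearMap.id ℝ OctE) x :=
    (hasFDerivAt_id x).sub_const a
  have h2 := (h1.norm_sq).sqrt (pow_ne_zero 2 hn)
  simp only [Real.sqrt_sq (norm_nonneg _)] at h2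
  have h3 := (hasDerivAt_inv hn).comp_hasFDerivAt x h2
  refine h3.congr_fderiv ?_
  ext v
  simp
  field_simp

noncomputable def octD (a x : OctE) : OctE →L[ℝ] ℝ :=
  (-(1/2) * (‖x - a‖⁻¹ ^ 3)) • innerSL ℝ (x - a)

lemma oct_first (a x : OctE) (h : x ≠ a) :
    HasFDerivAt (fun y : OctE => 1 / (2 * ‖y - a‖)) (octD a x) x := by
  have h1 := (oct_norm_inv a x h).const_mul (1/2)
  have e : (fun y : OctE => 1 / (2 * ‖y - a‖)) = fun y => 1/2 * ‖y - a‖⁻¹ := by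
    ext y; rw [one_div, mul_inv]; ring
  rw [e]
  refine h1.congr_fderiv ?_
  ext v
  simp [octD]
  ring

noncomputable def octI : OctE →L[ℝ] OctE →L[ℝ] ℝ := innerSL ℝ

noncomputable def octH (a : OctE) : OctE →L[ℝ] OctE →L[ℝ] ℝ :=
  (-(1/2) : ℝ) • octI + (3/2 : ℝ) • (innerSL ℝ a).smulRight (innerSL ℝ a)

lemma octH_apply (a v w : OctE) :
    octH a v w = -(1/2) * inner ℝ v w + 3/2 * (inner ℝ a v * inner ℝ a w) := by
  have e : octI v w = inner ℝ v w := rfl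
  simp [octH, e]

lemma oct_second (a : OctE) (h : ‖a‖ = 1) : HasFDerivAt (octD a) (octH a) 0 := by
  have ha : (0 : OctE) ≠ a := by
    rintro rfl; simp at h
  have h1 := ((oct_norm_inv a 0 ha).pow 3).const_mul (-(1/2))
  have h2 : HasFDerivAt (fun y : OctE => innerSL ℝ (y - a)) octI 0 :=
    octI.hasFDerivAt.comp (0 : OctE)
      ((hasFDerivAt_id (0 : OctE)).sub_const a)
  refine (h1.smul h2).congr_fderiv ?_
  ext v w
  have e : octI v w = inner ℝ v w := rfl
  rw [octH_apply]
  simp [h, e]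
  ring

theorem octahedron_potential_flat_at_origin
    (phi : EuclideanSpace ℝ (Fin 3) → ℝ)
    (hphi : phi = fun x => ∑ i : Fin 3,
      (1 / (2 * ‖x - EuclideanSpace.single i (1:ℝ)‖) +
       1 / (2 * ‖x + EuclideanSpace.single i (1:ℝ)‖))) :
    fderiv ℝ phi 0 = 0 ∧ iteratedFDeriv ℝ 2 phi 0 = 0 ∧ ¬ IsLocalMax phi 0 := by
  have hphi' : phi = fun x => ∑ i : Fin 3,
      (1 / (2 * ‖x - EuclideanSpace.single i (1:ℝ)‖) +
       1 / (2 * ‖x - (-EuclideanSpace.single i (1:ℝ))‖)) := by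
    simp only [hphi, sub_neg_eq_add]
  have hd : ∀ x : OctE, ‖x‖ < 1 → HasFDerivAt phi (∑ i : Fin 3,
      (octD (EuclideanSpace.single i (1:ℝ)) x + octD (-EuclideanSpace.single i (1:ℝ)) x)) x := by
    intro x hx
    rw [hphi']
    refine HasFDerivAt.fun_sum fun i _ => ?_
    refine (oct_first _ _ ?_).add (oct_first _ _ ?_)
    · rintro rfl; simp at hx
    · rintro rfl; simp at hx
  have hev : fderiv ℝ phi =ᶠ[nhds 0] fun x => ∑ i : Fin 3,
      (octD (EuclideanSpace.single i (1:ℝ)) x + octD (-EuclideanSpace.single i (1:ℝ)) x) := by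
    filter_upwards [Metric.ball_mem_nhds (0 : OctE) one_pos] with x hx
    exact (hd x (by simpa using hx)).fderiv
  refine ⟨?_, ?_, ?_⟩
  · rw [hev.eq_of_nhds]
    ext v
    simp [octD]
  · ext m
    rw [iteratedFDeriv_two_apply, hev.fderiv_eq]
    have h2 : HasFDerivAt (fun x => ∑ i : Fin 3,
      (octD (EuclideanSpace.single i (1:ℝ)) x + octD (-EuclideanSpace.single i (1:ℝ)) x))
      (∑ i : Fin 3, (octH (EuclideanSpace.single i (1:ℝ)) + octH (-EuclideanSpace.single i (1:ℝ)))) 0 := by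
      refine HasFDerivAt.fun_sum fun i _ => ?_
      exact (oct_second _ (by simp)).add (oct_second _ (by simp))
    rw [h2.fderiv]
    simp only [Fin.sum_univ_three, add_apply, octH_apply]
    simp [PiLp.inner_apply, Fin.sum_univ_three]
    ring
  · intro hmax
    have hc : Filter.Tendsto (fun t : ℝ => (EuclideanSpace.single 0 t : OctE)) (nhdsWithin 0 (Set.Ioi 0)) (nhds 0) := by
      have : Filter.Tendsto (fun t : ℝ => t • (EuclideanSpace.single 0 1 : OctE)) (nhds 0) (nhds ((0:ℝ) • (EuclideanSpace.single 0 1 : OctE))) :=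
        (continuous_id.smul continuous_const).tendsto 0
      rw [zero_smul] at this
      refine (this.mono_left nhdsWithin_le_nhds).congr fun t => ?_
      ext i
      fin_cases i <;> simp
    have h1 := hc.eventually hmax
    obtain ⟨t, ht, ht1⟩ := (h1.and (Ioo_mem_nhdsGT (show (0:ℝ) < 1 by norm_num))).exists
    obtain ⟨h0, h1'⟩ := ht1
    have e0 : phi 0 = 3 := by
      rw [hphi]; simp; norm_num
    have et : phi (EuclideanSpace.single 0 t) = 1/(2*(1-t)) + 1/(2*(1+t)) + 2 / √(1+t^2) := by
      rw [hphi]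
      have a1 : √((t-1)^2) = 1 - t := by
        rw [Real.sqrt_sq_eq_abs, abs_of_neg (by linarith)]; ring
      have a2 : √((t+1)^2) = 1 + t := by
        rw [Real.sqrt_sq (by linarith)]; ring
      simp [Fin.sum_univ_three, EuclideanSpace.norm_eq, a1, a2]
      rw [add_comm (t^2) 1]
      ring
    rw [e0, et] at ht
    have b1 : 1/(2*(1-t)) + 1/(2*(1+t)) > 1 + t^2 := by
      have p : 0 < 1 - t := by linarith
      have q : 0 < 1 + t := by linarith
      have : 1/(2*(1-t)) + 1/(2*(1+t)) = 1 / ((1-t)*(1+t)) := by field_simp; ring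
      rw [this, gt_iff_lt, lt_div_iff₀ (by positivity)]
      nlinarith [pow_pos h0 4]
    have b2 : 2 / √(1+t^2) ≥ 2 - t^2 := by
      have s : √(1+t^2) ≤ 1 + t^2/2 := by
        rw [Real.sqrt_le_left (by positivity)]; nlinarith [sq_nonneg (t^2)]
      rw [ge_iff_le, le_div_iff₀ (by positivity)]
      nlinarith [sq_nonneg (t^2), mul_le_mul_of_nonneg_left s (by nlinarith : (0:ℝ) ≤ 2 - t^2)]
    linarith
end

section
/- Let m > 0, and for x ∈ ℝ³ \ {0} set r = ‖x‖ and φ(x) = m + 1/(2r). Define the 3×3 matrix-valued function W with entries W_{ii} = (φ·∂²φ/∂xᵢ² − 2(∂φ/∂xᵢ)² + (∂φ/∂xⱼ)² + (∂φ/∂x_k)²)/(2φ³) for each cyclic permutation (i,j,k) of (1,2,3), and W_{ij} = (φ·∂²φ/∂xᵢ∂xⱼ − 3(∂φ/∂xᵢ)(∂φ/∂xⱼ))/(2φ³) for i ≠ j. Then for every x ∈ ℝ³ \ {0}, the sum of the squares of the nine entries of W(x) equals 24m²/(2m‖x‖ + 1)⁶. In particular, this quantity never vanishes. -/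
lemma tn_norm {x : EuclideanSpace ℝ (Fin 3)} (hx : x ≠ 0) :
    HasFDerivAt (fun y : EuclideanSpace ℝ (Fin 3) => ‖y‖) (‖x‖⁻¹ • innerSL ℝ x) x := by
  have h := (hasStrictFDerivAt_norm_sq x).hasFDerivAt
  have hr : ‖x‖ ≠ 0 := norm_ne_zero_iff.mpr hx
  have h2 := h.sqrt (by positivity)
  simp only [Real.sqrt_sq (norm_nonneg _)] at h2
  refine h2.congr_fderiv ?_
  ext v
  simp
  field_simp

lemma tn_first (m : ℝ) {x : EuclideanSpace ℝ (Fin 3)} (hx : x ≠ 0) :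
    HasFDerivAt (fun y : EuclideanSpace ℝ (Fin 3) => m + 1 / (2 * ‖y‖))
      ((-(1 / 2) * (‖x‖ ^ 3)⁻¹) • innerSL ℝ x) x := by
  have hr : ‖x‖ ≠ 0 := norm_ne_zero_iff.mpr hx
  have hd : HasDerivAt (fun t : ℝ => m + 1 / (2 * t)) (-(1 / 2) * (‖x‖ ^ 2)⁻¹) ‖x‖ := by
    have := (((hasDerivAt_id ‖x‖).const_mul 2).inv (by simpa using hr)).const_add m
    simp only [id] at this
    refine (this.congr_deriv ?_).congr_of_eventuallyEq (.of_forall fun t => by simp)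
    field_simp
  refine (hd.comp_hasFDerivAt x (tn_norm hx)).congr_fderiv ?_
  rw [smul_smul]
  congr 1
  field_simp

lemma tn_second (m : ℝ) {x : EuclideanSpace ℝ (Fin 3)} (hx : x ≠ 0)
    (u v : EuclideanSpace ℝ (Fin 3)) :
    iteratedFDeriv ℝ 2 (fun y : EuclideanSpace ℝ (Fin 3) => m + 1 / (2 * ‖y‖)) x ![u, v]
      = 3 / 2 * (‖x‖ ^ 5)⁻¹ * inner ℝ x u * inner ℝ x v
        - 1 / 2 * (‖x‖ ^ 3)⁻¹ * inner ℝ u v := by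
  have hr : ‖x‖ ≠ 0 := norm_ne_zero_iff.mpr hx
  rw [iteratedFDeriv_two_apply]
  have he : fderiv ℝ (fun y : EuclideanSpace ℝ (Fin 3) => m + 1 / (2 * ‖y‖)) =ᶠ[nhds x]
      fun y => (-(1 / 2) * (‖y‖ ^ 3)⁻¹) • innerSL ℝ y := by
    filter_upwards [isOpen_ne.mem_nhds hx] with y hy
    exact (tn_first m hy).fderiv
  rw [he.fderiv_eq]
  have hd : HasDerivAt (fun t : ℝ => -(1 / 2) * (t ^ 3)⁻¹) (3 / 2 * (‖x‖ ^ 4)⁻¹) ‖x‖ := by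
    have := ((hasDerivAt_pow 3 ‖x‖).inv (by positivity)).const_mul (-(1 / 2) : ℝ)
    refine this.congr_deriv ?_
    field_simp
    norm_num
    ring
  have h1 := hd.comp_hasFDerivAt x (tn_norm hx)
  have h2 := h1.smul (innerSL ℝ (E := EuclideanSpace ℝ (Fin 3))).hasFDerivAt
  have h3 := h2.fderiv
  simp only [Function.comp_def, Pi.smul_def'] at h3
  rw [h3]
  change (-(1 / 2) * (‖x‖ ^ 3)⁻¹) * inner ℝ u v +
    (3 / 2 * (‖x‖ ^ 4)⁻¹ * (‖x‖⁻¹ * inner ℝ x u)) * inner ℝ x v = _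
  field_simp
  ring

/-- For the Taub-NUT potential `φ(x) = m + 1/(2‖x‖)`, the squared norm of the
anti-self-dual curvature operator `W` of the associated Gibbons–Hawking metric
equals `24m²/(2m‖x‖+1)⁶`, which never vanishes. -/
theorem taub_nut_curvature_norm
    (m : ℝ) (hm : 0 < m)
    (phi : EuclideanSpace ℝ (Fin 3) → ℝ)
    (hphi : phi = fun x => m + 1 / (2 * ‖x‖))
    (W : EuclideanSpace ℝ (Fin 3) → Matrix (Fin 3) (Fin 3) ℝ)
    (hW : ∀ x i j, W x i j =
      (phi x * iteratedFDeriv ℝ 2 phi x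
          ![EuclideanSpace.single i (1:ℝ), EuclideanSpace.single j (1:ℝ)]
        - 3 * fderiv ℝ phi x (EuclideanSpace.single i (1:ℝ))
            * fderiv ℝ phi x (EuclideanSpace.single j (1:ℝ))
        + (if i = j then
            ∑ l : Fin 3, (fderiv ℝ phi x (EuclideanSpace.single l (1:ℝ))) ^ 2
           else 0))
        / (2 * (phi x) ^ 3)) :
    ∀ x : EuclideanSpace ℝ (Fin 3), x ≠ 0 →
      (∑ i : Fin 3, ∑ j : Fin 3, (W x i j) ^ 2
          = 24 * m ^ 2 / (2 * m * ‖x‖ + 1) ^ 6) ∧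
        24 * m ^ 2 / (2 * m * ‖x‖ + 1) ^ 6 ≠ 0 := by
  intro x hx
  have hr : 0 < ‖x‖ := norm_pos_iff.mpr hx
  have hs : x 0 ^ 2 + x 1 ^ 2 + x 2 ^ 2 = ‖x‖ ^ 2 := by
    rw [EuclideanSpace.real_norm_sq_eq, Fin.sum_univ_three]
  have h1 : ∀ i, fderiv ℝ phi x (EuclideanSpace.single i (1:ℝ))
      = -(1 / 2) * (‖x‖ ^ 3)⁻¹ * x i := by
    intro i
    rw [hphi, (tn_first m hx).fderiv]
    simp [EuclideanSpace.inner_single_right]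
  have h2 : ∀ i j, iteratedFDeriv ℝ 2 phi x
      ![EuclideanSpace.single i (1:ℝ), EuclideanSpace.single j (1:ℝ)]
      = 3 / 2 * (‖x‖ ^ 5)⁻¹ * x i * x j - 1 / 2 * (‖x‖ ^ 3)⁻¹ * (if i = j then 1 else 0) := by
    intro i j
    rw [hphi, tn_second m hx]
    simp [EuclideanSpace.inner_single_right, PiLp.single_apply, eq_comm]
  have hp : phi x = (2 * m * ‖x‖ + 1) / (2 * ‖x‖) := by
    rw [hphi]; field_simp
  have hq : 0 < 2 * m * ‖x‖ + 1 := by positivity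
  have hw : ∀ i j, W x i j = 2 * m / (2 * m * ‖x‖ + 1) ^ 3 *
      (3 * x i * x j / ‖x‖ ^ 2 - (if i = j then 1 else 0)) := by
    intro i j
    have hsum : ∑ l : Fin 3, (fderiv ℝ phi x (EuclideanSpace.single l (1:ℝ))) ^ 2
        = 1 / 4 * (‖x‖ ^ 4)⁻¹ := by
      simp only [h1, Fin.sum_univ_three]
      have : ∀ c : ℝ, (c * x 0) ^ 2 + (c * x 1) ^ 2 + (c * x 2) ^ 2 = c ^ 2 * ‖x‖ ^ 2 := by
        intro c; rw [← hs]; ring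
      rw [this]
      field_simp
      norm_num
    rw [hW, hsum, h1, h1, h2, hp]
    generalize ‖x‖ = r at *
    split_ifs <;> field_simp <;> ring
  refine ⟨?_, by positivity⟩
  simp only [hw, mul_pow, ← Finset.mul_sum]
  have key : ∑ i : Fin 3, ∑ j : Fin 3,
      (3 * x i * x j / ‖x‖ ^ 2 - (if i = j then (1:ℝ) else 0)) ^ 2 = 6 := by
    have e : ∑ i : Fin 3, ∑ j : Fin 3,
        (3 * x i * x j / ‖x‖ ^ 2 - (if i = j then (1:ℝ) else 0)) ^ 2
        = 9 * ((x 0 ^ 2 + x 1 ^ 2 + x 2 ^ 2) / ‖x‖ ^ 2) ^ 2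
          - 6 * ((x 0 ^ 2 + x 1 ^ 2 + x 2 ^ 2) / ‖x‖ ^ 2) + 3 := by
      simp [Fin.sum_univ_three]
      ring
    rw [e, hs, div_self (by positivity)]
    norm_num
  rw [key]
  field_simp
  norm_num
end

section
/- Let k₁, k₂ > 0, let p = (0,0,1) ∈ ℝ³, and for x ∈ ℝ³ \ {p, −p} set r₁ = ‖x − p‖, r₂ = ‖x + p‖ and φ(x) = k₁/(2r₁) + k₂/(2r₂). Define the 3×3 matrix-valued function W with entries W_{ii} = (φ·∂²φ/∂xᵢ² − 2(∂φ/∂xᵢ)² + (∂φ/∂xⱼ)² + (∂φ/∂x_k)²)/(2φ³) for each cyclic permutation (i,j,k) of (1,2,3), and W_{ij} = (φ·∂²φ/∂xᵢ∂xⱼ − 3(∂φ/∂xᵢ)(∂φ/∂xⱼ))/(2φ³) for i ≠ j. Then for every x ∈ ℝ³ \ {p, −p}, the sum of the squares of the nine entries of W(x) equals 96·k₁²·k₂²/(k₁·r₂ + k₂·r₁)⁶. In particular, this quantity never vanishes. -/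
abbrev EH3 := EuclideanSpace ℝ (Fin 3)

lemma eh_norm (c x : EH3) (h : x ≠ c) :
    HasFDerivAt (fun y : EH3 => ‖y - c‖) (‖x - c‖⁻¹ • innerSL ℝ (x - c)) x := by
  have hr : ‖x - c‖ ≠ 0 := norm_ne_zero_iff.2 (sub_ne_zero.2 h)
  have h1 : HasFDerivAt (fun y : EH3 => ‖y - c‖ ^ 2) _ x :=
    ((hasFDerivAt_id x).sub_const c).norm_sq
  have h2 := h1.sqrt (by positivity)
  have h3 : (fun y : EH3 => √(‖y - c‖ ^ 2)) = fun y => ‖y - c‖ := by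
    funext y; exact Real.sqrt_sq (norm_nonneg _)
  rw [h3] at h2
  refine h2.congr_fderiv ?_
  ext a
  simp
  field_simp

lemma eh_first (k : ℝ) (c x : EH3) (h : x ≠ c) :
    HasFDerivAt (fun y : EH3 => k / (2 * ‖y - c‖))
      ((-(k / 2) * (‖x - c‖ ^ 3)⁻¹) • innerSL ℝ (x - c)) x := by
  have hr : ‖x - c‖ ≠ 0 := norm_ne_zero_iff.2 (sub_ne_zero.2 h)
  have h1 : HasDerivAt (fun r : ℝ => k / 2 * r⁻¹) _ ‖x - c‖ :=
    (hasDerivAt_inv hr).const_mul (k / 2)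
  have h2 := h1.comp_hasFDerivAt x (eh_norm c x h)
  have h3 : ((fun r : ℝ => k / 2 * r⁻¹) ∘ fun y : EH3 => ‖y - c‖)
      = fun y => k / (2 * ‖y - c‖) := by
    funext y; simp [div_eq_mul_inv]; ring
  rw [h3] at h2
  refine h2.congr_fderiv ?_
  ext a
  simp
  field_simp

lemma eh_second (k : ℝ) (c x : EH3) (h : x ≠ c) :
    ∃ L : EH3 →L[ℝ] (EH3 →L[ℝ] ℝ), HasFDerivAt
      (fun y : EH3 => (-(k / 2) * (‖y - c‖ ^ 3)⁻¹) • innerSL ℝ (y - c)) L x ∧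
      ∀ a b, L a b = (k / 2) * (3 * inner ℝ (x - c) a * inner ℝ (x - c) b / ‖x - c‖ ^ 5
        - inner ℝ a b / ‖x - c‖ ^ 3) := by
  have hr : ‖x - c‖ ≠ 0 := norm_ne_zero_iff.2 (sub_ne_zero.2 h)
  have h1 : HasDerivAt (fun r : ℝ => -(k / 2) * (r ^ 3)⁻¹) _ ‖x - c‖ :=
    ((hasDerivAt_pow 3 ‖x - c‖).inv (pow_ne_zero 3 hr)).const_mul (-(k / 2))
  have h2 := h1.comp_hasFDerivAt x (eh_norm c x h)
  have h3 : HasFDerivAt (fun y : EH3 => innerSL ℝ (y - c)) (innerSL ℝ : EH3 →L[ℝ] _) x := by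
    have := (innerSL ℝ : EH3 →L[ℝ] (EH3 →L[ℝ] ℝ)).hasFDerivAt.comp x
      ((hasFDerivAt_id x).sub_const c)
    exact this
  refine ⟨_, h2.smul h3, ?_⟩
  intro a b
  have h4 : ∀ a b : EH3, ((innerSL ℝ : EH3 →L[ℝ] (EH3 →L[ℝ] ℝ)) a) b = inner ℝ a b :=
    fun _ _ => rfl
  simp [inner_sub_left]
  rw [h4]
  field_simp
  ring

lemma eh_entry (a b r s ui uj vi vj d : ℝ) (hr : r ≠ 0) (hs : s ≠ 0)
    (hq : a * s + b * r ≠ 0) :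
    ((a / r + b / s) * (a * (3 * ui * uj / r ^ 5 - d / r ^ 3)
        + b * (3 * vi * vj / s ^ 5 - d / s ^ 3))
      - 3 * (-a * (r ^ 3)⁻¹ * ui + -b * (s ^ 3)⁻¹ * vi)
        * (-a * (r ^ 3)⁻¹ * uj + -b * (s ^ 3)⁻¹ * vj)
      + d * (a ^ 2 / r ^ 4 + b ^ 2 / s ^ 4 + a * b * (r ^ 2 + s ^ 2 - 4) / (r ^ 3 * s ^ 3)))
      / (2 * (a / r + b / s) ^ 3)
    = a * b / (2 * (a * s + b * r) ^ 3) *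
      (3 * (ui * s / r - vi * r / s) * (uj * s / r - vj * r / s) - 4 * d) := by
  have e : a / r + b / s = (a * s + b * r) / (r * s) := by field_simp
  rw [e]
  generalize hQ : a * s + b * r = Q at *
  field_simp
  rw [← hQ]
  ring


/-- For the (orbifold) Eguchi–Hanson potential `φ = k₁/(2r₁) + k₂/(2r₂)` with
poles at `±p`, `p = (0,0,1)`, the squared norm of the anti-self-dual curvature
operator `W` of the associated Gibbons–Hawking metric equals
`96k₁²k₂²/(k₁r₂ + k₂r₁)⁶`, which never vanishes. -/
theorem eguchi_hanson_curvature_norm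
    (k₁ k₂ : ℝ) (hk₁ : 0 < k₁) (hk₂ : 0 < k₂)
    (p : EuclideanSpace ℝ (Fin 3)) (hp : p = EuclideanSpace.single 2 (1:ℝ))
    (phi : EuclideanSpace ℝ (Fin 3) → ℝ)
    (hphi : phi = fun x => k₁ / (2 * ‖x - p‖) + k₂ / (2 * ‖x + p‖))
    (W : EuclideanSpace ℝ (Fin 3) → Matrix (Fin 3) (Fin 3) ℝ)
    (hW : ∀ x i j, W x i j =
      (phi x * iteratedFDeriv ℝ 2 phi x
          ![EuclideanSpace.single i (1:ℝ), EuclideanSpace.single j (1:ℝ)]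
        - 3 * fderiv ℝ phi x (EuclideanSpace.single i (1:ℝ))
            * fderiv ℝ phi x (EuclideanSpace.single j (1:ℝ))
        + (if i = j then
            ∑ l : Fin 3, (fderiv ℝ phi x (EuclideanSpace.single l (1:ℝ))) ^ 2
           else 0))
        / (2 * (phi x) ^ 3)) :
    ∀ x : EuclideanSpace ℝ (Fin 3), x ≠ p → x ≠ -p →
      (∑ i : Fin 3, ∑ j : Fin 3, (W x i j) ^ 2
          = 96 * k₁ ^ 2 * k₂ ^ 2 / (k₁ * ‖x + p‖ + k₂ * ‖x - p‖) ^ 6) ∧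
        96 * k₁ ^ 2 * k₂ ^ 2 / (k₁ * ‖x + p‖ + k₂ * ‖x - p‖) ^ 6 ≠ 0 := by
  intro x hx1 hx2
  have hu : x - p ≠ 0 := sub_ne_zero.2 hx1
  have hv : x + p ≠ 0 := fun h => hx2 (eq_neg_of_add_eq_zero_left h)
  have hr : 0 < ‖x - p‖ := norm_pos_iff.2 hu
  have hs : 0 < ‖x + p‖ := norm_pos_iff.2 hv
  have hQ : 0 < k₁ * ‖x + p‖ + k₂ * ‖x - p‖ := by positivity
  refine ⟨?_, by positivity⟩
  have hphi' : phi = fun y => k₁ / (2 * ‖y - p‖) + k₂ / (2 * ‖y - (-p)‖) := by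
    rw [hphi]; simp only [sub_neg_eq_add]
  have hD : ∀ y, y ≠ p → y ≠ -p → HasFDerivAt phi
      ((-(k₁ / 2) * (‖y - p‖ ^ 3)⁻¹) • innerSL ℝ (y - p)
        + (-(k₂ / 2) * (‖y - (-p)‖ ^ 3)⁻¹) • innerSL ℝ (y - (-p))) y := by
    intro y h1 h2
    rw [hphi']
    exact (eh_first k₁ p y h1).add (eh_first k₂ (-p) y h2)
  have hev : fderiv ℝ phi =ᶠ[nhds x] fun y =>
      ((-(k₁ / 2) * (‖y - p‖ ^ 3)⁻¹) • innerSL ℝ (y - p)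
        + (-(k₂ / 2) * (‖y - (-p)‖ ^ 3)⁻¹) • innerSL ℝ (y - (-p))) := by
    filter_upwards [isOpen_ne.mem_nhds hx1, isOpen_ne.mem_nhds hx2] with y h1 h2
    exact (hD y h1 h2).fderiv
  obtain ⟨L1, hL1, hL1'⟩ := eh_second k₁ p x hx1
  obtain ⟨L2, hL2, hL2'⟩ := eh_second k₂ (-p) x hx2
  have hDD : fderiv ℝ (fderiv ℝ phi) x = L1 + L2 :=
    ((hL1.add hL2).congr_of_eventuallyEq hev).fderiv
  have hg : ∀ i : Fin 3, fderiv ℝ phi x (EuclideanSpace.single i (1:ℝ))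
      = -(k₁ / 2) * (‖x - p‖ ^ 3)⁻¹ * (x - p) i + -(k₂ / 2) * (‖x + p‖ ^ 3)⁻¹ * (x + p) i := by
    intro i
    rw [(hD x hx1 hx2).fderiv]
    simp [EuclideanSpace.inner_single_right]
    ring
  have hH : ∀ i j : Fin 3, iteratedFDeriv ℝ 2 phi x
      ![EuclideanSpace.single i (1:ℝ), EuclideanSpace.single j (1:ℝ)]
      = (k₁ / 2) * (3 * (x - p) i * (x - p) j / ‖x - p‖ ^ 5
          - (if i = j then 1 else 0) / ‖x - p‖ ^ 3)
        + (k₂ / 2) * (3 * (x + p) i * (x + p) j / ‖x + p‖ ^ 5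
          - (if i = j then 1 else 0) / ‖x + p‖ ^ 3) := by
    intro i j
    rw [iteratedFDeriv_two_apply, hDD]
    simp only [Matrix.cons_val_zero, Matrix.cons_val_one, add_apply,
      hL1', hL2', sub_neg_eq_add]
    have : inner ℝ (EuclideanSpace.single i (1:ℝ)) (EuclideanSpace.single j (1:ℝ))
        = if i = j then (1:ℝ) else 0 := by
      simp [EuclideanSpace.inner_single_right, Pi.single_apply, eq_comm]
    rw [this]
    simp [EuclideanSpace.inner_single_right]
  have hr2 : ‖x - p‖ ^ 2 = (x - p) 0 ^ 2 + (x - p) 1 ^ 2 + (x - p) 2 ^ 2 := by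
    rw [EuclideanSpace.real_norm_sq_eq, Fin.sum_univ_three]
  have hs2 : ‖x + p‖ ^ 2 = (x + p) 0 ^ 2 + (x + p) 1 ^ 2 + (x + p) 2 ^ 2 := by
    rw [EuclideanSpace.real_norm_sq_eq, Fin.sum_univ_three]
  have hv0 : (x + p) 0 = (x - p) 0 := by simp [hp]
  have hv1 : (x + p) 1 = (x - p) 1 := by simp [hp]
  have hv2 : (x + p) 2 = (x - p) 2 + 2 := by simp [hp]; ring
  have hφ : phi x = (k₁ / 2) / ‖x - p‖ + (k₂ / 2) / ‖x + p‖ := by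
    rw [hphi]; simp only [div_div]
  simp only [hW, hg, hH, hφ]
  generalize hu' : (fun i => (x - p) i) = u at *
  generalize hv' : (fun i => (x + p) i) = v at *
  have hu'' : ∀ i, (x - p) i = u i := fun i => congrFun hu' i
  have hv'' : ∀ i, (x + p) i = v i := fun i => congrFun hv' i
  simp only [hu'', hv''] at *
  clear hu'' hv'' hu' hv' hW hg hH hφ hDD hL1 hL2 hL1' hL2' hev hD hphi hphi'
  generalize ‖x - p‖ = r at *
  generalize ‖x + p‖ = s at *
  obtain ⟨a, rfl⟩ : ∃ a, k₁ = 2 * a := ⟨k₁ / 2, by ring⟩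
  obtain ⟨b, rfl⟩ : ∃ b, k₂ = 2 * b := ⟨k₂ / 2, by ring⟩
  have ha : 2 * a / 2 = a := by ring
  have hb : 2 * b / 2 = b := by ring
  rw [ha, hb]
  have hq : a * s + b * r ≠ 0 := by intro h; nlinarith
  have hS : ∑ l : Fin 3, (-a * (r ^ 3)⁻¹ * u l + -b * (s ^ 3)⁻¹ * v l) ^ 2
      = a ^ 2 / r ^ 4 + b ^ 2 / s ^ 4 + a * b * (r ^ 2 + s ^ 2 - 4) / (r ^ 3 * s ^ 3) := by
    have e : ∑ l : Fin 3, (-a * (r ^ 3)⁻¹ * u l + -b * (s ^ 3)⁻¹ * v l) ^ 2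
      = a ^ 2 * ((r ^ 3)⁻¹) ^ 2 * r ^ 2 + b ^ 2 * ((s ^ 3)⁻¹) ^ 2 * s ^ 2
        + a * b * (r ^ 3)⁻¹ * (s ^ 3)⁻¹ * (r ^ 2 + s ^ 2 - 4) := by
      rw [hr2, hs2, Fin.sum_univ_three, hv0, hv1, hv2]; ring
    rw [e]; field_simp
  have hE : ∀ i j : Fin 3, (if i = j then
      ∑ l : Fin 3, (-a * (r ^ 3)⁻¹ * u l + -b * (s ^ 3)⁻¹ * v l) ^ 2 else 0)
      = (if i = j then (1:ℝ) else 0) * (a ^ 2 / r ^ 4 + b ^ 2 / s ^ 4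
        + a * b * (r ^ 2 + s ^ 2 - 4) / (r ^ 3 * s ^ 3)) := by
    intro i j; rw [hS]; simp
  simp only [hE, eh_entry a b r s _ _ _ _ _ hr.ne' hs.ne' hq]
  have hw : (u 0 * s / r - v 0 * r / s) ^ 2 + (u 1 * s / r - v 1 * r / s) ^ 2
      + (u 2 * s / r - v 2 * r / s) ^ 2 = 4 := by
    have e : (u 0 * s / r - v 0 * r / s) ^ 2 + (u 1 * s / r - v 1 * r / s) ^ 2
      + (u 2 * s / r - v 2 * r / s) ^ 2
      = (u 0 ^ 2 + u 1 ^ 2 + u 2 ^ 2) * s ^ 2 / r ^ 2 + (v 0 ^ 2 + v 1 ^ 2 + v 2 ^ 2) * r ^ 2 / s ^ 2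
        - 2 * (u 0 * v 0 + u 1 * v 1 + u 2 * v 2) := by
      field_simp; ring
    rw [e, ← hr2, ← hs2]
    have e1 : r ^ 2 * s ^ 2 / r ^ 2 = s ^ 2 := by field_simp
    have e2 : s ^ 2 * r ^ 2 / s ^ 2 = r ^ 2 := by field_simp
    rw [e1, e2, hr2, hs2, hv0, hv1, hv2]; ring
  generalize hω : (fun i => u i * s / r - v i * r / s) = w at *
  have hω' : ∀ i, u i * s / r - v i * r / s = w i := fun i => congrFun hω i
  simp only [hω'] at *
  have key : ∑ i : Fin 3, ∑ j : Fin 3, (a * b / (2 * (a * s + b * r) ^ 3) *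
      (3 * w i * w j - 4 * (if i = j then 1 else 0))) ^ 2
      = (a * b / (2 * (a * s + b * r) ^ 3)) ^ 2 *
        (9 * (w 0 ^ 2 + w 1 ^ 2 + w 2 ^ 2) ^ 2 - 24 * (w 0 ^ 2 + w 1 ^ 2 + w 2 ^ 2) + 48) := by
    generalize a * b / (2 * (a * s + b * r) ^ 3) = C
    simp [Fin.sum_univ_three]
    ring
  rw [key, hw]
  have e3 : 2 * a * s + 2 * b * r = 2 * (a * s + b * r) := by ring
  rw [e3]
  field_simp
  ring
end

section
/- Let k ≥ 2, let P₁, …, P_k ∈ ℝ³ be distinct points, let m ≥ 0, and define φ : ℝ³ \ {P₁, …, P_k} → ℝ by φ(x) = m + Σ_{i=1}^{k} 1/(2‖x − Pᵢ‖). Then φ has at least one critical point, i.e. there exists x ∈ ℝ³ \ {P₁, …, P_k} at which the derivative of φ vanishes. -/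
open Filter Topology Set

section MountainPass

variable {E : Type*} [NormedAddCommGroup E] [InnerProductSpace ℝ E] [CompleteSpace E]

lemma mp_grad_cont {ψ : E → ℝ} {x : E} (h : ContDiffAt ℝ 1 ψ x) :
    ContinuousAt (gradient ψ) x := by
  have h1 : ContinuousAt (fderiv ℝ ψ) x := h.continuousAt_fderiv (by norm_num)
  exact (InnerProductSpace.toDual ℝ E).symm.continuous.continuousAt.comp h1

/-- Uniform decrease along the negative gradient on a compact set. -/
lemma mp_descent {ψ : E → ℝ} (hc : Continuous ψ) {K : Set E} (hK : IsCompact K)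
    (hKpos : ∀ x ∈ K, 0 < ψ x)
    (hd : ∀ x, 0 < ψ x → ContDiffAt ℝ 1 ψ x)
    (hg : ∀ x, 0 < ψ x → gradient ψ x ≠ 0) :
    ∃ t > 0, ∀ x ∈ K, StrictAntiOn (fun s : ℝ => ψ (x - s • gradient ψ x)) (Icc 0 t) := by
  have key : ∀ x ∈ K, ∀ᶠ z : ℝ × E in 𝓝 ((0 : ℝ), x),
      0 < ψ (z.2 - z.1 • gradient ψ z.2) ∧
      0 < inner ℝ (gradient ψ (z.2 - z.1 • gradient ψ z.2)) (gradient ψ z.2) := by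
    intro x hx
    have hG := mp_grad_cont (hd x (hKpos x hx))
    have h1 : ContinuousAt (fun z : ℝ × E => gradient ψ z.2) ((0 : ℝ), x) :=
      ContinuousAt.comp (f := fun z : ℝ × E => z.2) (x := ((0 : ℝ), x)) hG continuousAt_snd
    have h2 : ContinuousAt (fun z : ℝ × E => z.2 - z.1 • gradient ψ z.2) ((0 : ℝ), x) :=
      continuousAt_snd.sub (continuousAt_fst.smul h1)
    have h3 : ContinuousAt (fun z : ℝ × E => gradient ψ (z.2 - z.1 • gradient ψ z.2))
        ((0 : ℝ), x) := by
      refine ContinuousAt.comp (g := gradient ψ) (f := fun z : ℝ × E => z.2 - z.1 • gradient ψ z.2)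
        (x := ((0 : ℝ), x)) ?_ h2
      simpa using hG
    have h4 : ContinuousAt (fun z : ℝ × E => ψ (z.2 - z.1 • gradient ψ z.2)) ((0 : ℝ), x) :=
      ContinuousAt.comp (g := ψ) hc.continuousAt h2
    have h5 := ContinuousAt.inner (𝕜 := ℝ) h3 h1
    refine (h4.eventually_const_lt ?_).and (h5.eventually_const_lt ?_)
    · simpa using hKpos x hx
    · have hpos : 0 < ‖gradient ψ x‖ := norm_pos_iff.2 (hg x (hKpos x hx))
      simpa using pow_pos hpos 2
  have ev := hK.eventually_forall_of_forall_eventually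
    (P := fun (s : ℝ) (x : E) => 0 < ψ (x - s • gradient ψ x) ∧
      0 < inner ℝ (gradient ψ (x - s • gradient ψ x)) (gradient ψ x)) key
  obtain ⟨t, ht, hball⟩ := Metric.eventually_nhds_iff.1 ev
  refine ⟨t / 2, by positivity, fun x hx => ?_⟩
  have hs : ∀ s ∈ Icc (0 : ℝ) (t / 2), HasDerivAt (fun s : ℝ => ψ (x - s • gradient ψ x))
      (- inner ℝ (gradient ψ (x - s • gradient ψ x)) (gradient ψ x)) s ∧
      0 < inner ℝ (gradient ψ (x - s • gradient ψ x)) (gradient ψ x) := by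
    intro s hs
    have hb := hball (y := s) (by rw [Real.dist_eq, sub_zero, abs_of_nonneg hs.1]; linarith [hs.2]) x hx
    refine ⟨?_, hb.2⟩
    have hdiff := ((hd _ hb.1).differentiableAt (by norm_num)).hasGradientAt.hasFDerivAt
    have hline : HasDerivAt (fun s : ℝ => x - s • gradient ψ x) (-gradient ψ x) s := by
      have := ((hasDerivAt_id s).smul_const (gradient ψ x)).const_sub x
      simpa using this
    have := hdiff.comp_hasDerivAt s hline
    rw [InnerProductSpace.toDual_apply_apply, inner_neg_right] at this
    exact this
  refine strictAntiOn_of_deriv_neg (convex_Icc _ _)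
    (fun s h => (hs s h).1.continuousAt.continuousWithinAt) (fun s h => ?_)
  have h' := hs s (interior_subset h)
  rw [h'.1.deriv]
  linarith [h'.2]

lemma mp_connected {ψ : E → ℝ} (hc : Continuous ψ) (hK : ∀ M, IsCompact {x | ψ x ≤ M})
    (hd : ∀ x, 0 < ψ x → ContDiffAt ℝ 1 ψ x)
    (hg : ∀ x, 0 < ψ x → gradient ψ x ≠ 0) {a b : E} (ha : ψ a ≤ 0) (hb : ψ b ≤ 0)
    {δ : ℝ} (hδ : 0 < δ) :
    ∃ C : Set E, IsPreconnected C ∧ a ∈ C ∧ b ∈ C ∧ ∀ x ∈ C, ψ x ≤ δ := by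
  obtain ⟨M, hM⟩ : ∃ M, ∀ x ∈ segment ℝ a b, ψ x ≤ M := by
    have hcs : IsCompact (segment ℝ a b) := by
      rw [segment_eq_image]
      exact isCompact_Icc.image (by fun_prop)
    obtain ⟨M, hM⟩ := hcs.bddAbove_image hc.continuousOn
    exact ⟨M, fun x hx => hM (mem_image_of_mem ψ hx)⟩
  have hR : IsCompact {x | ψ x ≤ M ∧ δ / 2 ≤ ψ x} :=
    (hK M).inter_right (isClosed_le continuous_const hc)
  obtain ⟨t, ht, hanti⟩ := mp_descent hc hR (fun x hx => by linarith [hx.2]) hd hg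
  set w : E → ℝ := fun x => min t (max 0 (ψ x - δ / 2)) with hw
  have hwc : Continuous w := by fun_prop
  set T : E → E := fun x => x - w x • gradient ψ x with hT
  have hw0 : ∀ x, ψ x ≤ δ / 2 → w x = 0 := fun x hx => by
    simp only [hw]; rw [max_eq_left (by linarith), min_eq_right ht.le]
  have hw1 : ∀ x, w x ∈ Icc 0 t := fun x => ⟨le_min ht.le (le_max_left _ _), min_le_left _ _⟩
  have hTc : Continuous T := by
    rw [continuous_iff_continuousAt]
    intro x
    by_cases hx : 0 < ψ x
    · exact continuousAt_id.sub (hwc.continuousAt.smul (mp_grad_cont (hd x hx)))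
    · have : T =ᶠ[𝓝 x] id := by
        have h1 : ∀ᶠ y in 𝓝 x, ψ y < δ / 2 :=
          hc.continuousAt.eventually_lt_const (by linarith)
        filter_upwards [h1] with y hy
        simp [hT, hw0 y hy.le]
      exact continuousAt_id.congr this.symm
  have hTle : ∀ x, ψ x ≤ M → ψ (T x) ≤ ψ x := by
    intro x hx
    rcases le_total (ψ x) (δ / 2) with h | h
    · simp [hT, hw0 x h]
    · have := (hanti x ⟨hx, h⟩).antitoneOn (left_mem_Icc.2 ht.le) (hw1 x) (hw1 x).1
      simpa [hT] using this
  have hTlt : ∀ x, ψ x ≤ M → δ ≤ ψ x → ψ (T x) < ψ x := by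
    intro x hx h
    have hpos : 0 < w x := lt_min ht (lt_max_of_lt_right (by linarith))
    have := (hanti x ⟨hx, by linarith⟩) (left_mem_Icc.2 ht.le) (hw1 x) hpos
    simpa [hT] using this
  have hTa : ∀ x, ψ x ≤ 0 → T x = x := fun x hx => by simp [hT, hw0 x (by linarith)]
  obtain ⟨ε, hε, hdec⟩ : ∃ ε > 0, ∀ x, ψ x ≤ M → δ ≤ ψ x → ψ (T x) ≤ ψ x - ε := by
    have hR' : IsCompact {x | ψ x ≤ M ∧ δ ≤ ψ x} :=
      (hK M).inter_right (isClosed_le continuous_const hc)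
    rcases eq_empty_or_nonempty {x | ψ x ≤ M ∧ δ ≤ ψ x} with he | hne
    · refine ⟨1, one_pos, fun x h1 h2 => ?_⟩
      have : x ∈ {x | ψ x ≤ M ∧ δ ≤ ψ x} := ⟨h1, h2⟩
      rw [he] at this
      exact this.elim
    · obtain ⟨x₀, hx₀, hmin⟩ := hR'.exists_isMinOn hne
        (hc.sub (hc.comp hTc)).continuousOn
      refine ⟨ψ x₀ - ψ (T x₀), by linarith [hTlt x₀ hx₀.1 hx₀.2], fun x h1 h2 => ?_⟩
      have := isMinOn_iff.1 hmin x ⟨h1, h2⟩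
      change ψ x₀ - ψ (T x₀) ≤ ψ x - ψ (T x) at this
      linarith
  have step : ∀ n : ℕ, ∃ C : Set E, IsPreconnected C ∧ a ∈ C ∧ b ∈ C ∧
      ∀ x ∈ C, ψ x ≤ M ∧ ψ x ≤ max δ (M - n * ε) := by
    intro n
    induction n with
    | zero =>
      exact ⟨segment ℝ a b, (convex_segment a b).isPreconnected, left_mem_segment ℝ a b,
        right_mem_segment ℝ a b, fun x hx => ⟨hM x hx, by simp [hM x hx]⟩⟩
    | succ n ih =>
      obtain ⟨C, hC, haC, hbC, hle⟩ := ih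
      refine ⟨T '' C, hC.image _ hTc.continuousOn, ⟨a, haC, hTa a ha⟩, ⟨b, hbC, hTa b hb⟩, ?_⟩
      rintro _ ⟨x, hx, rfl⟩
      obtain ⟨h1, h2⟩ := hle x hx
      have h3 := hTle x h1
      refine ⟨h3.trans h1, ?_⟩
      rcases le_total (ψ x) δ with h | h
      · exact le_max_of_le_left (h3.trans h)
      · have h4 := hdec x h1 h
        push_cast
        rcases le_max_iff.1 h2 with h5 | h5
        · exact le_max_of_le_left (h3.trans h5)
        · exact le_max_of_le_right (by linarith)
  obtain ⟨n, hn⟩ := exists_nat_gt (M / ε)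
  obtain ⟨C, hC, haC, hbC, hle⟩ := step n
  refine ⟨C, hC, haC, hbC, fun x hx => (hle x hx).2.trans ?_⟩
  have : M < n * ε := (div_lt_iff₀ hε).1 hn
  exact max_le le_rfl (by linarith)

end MountainPass

/-- The electrostatic potential of `k ≥ 2` unit point charges (with constant
background `m ≥ 0`) has at least one critical point. -/
theorem exists_critical_point
    {k : ℕ} (hk : 2 ≤ k)
    (P : Fin k → EuclideanSpace ℝ (Fin 3)) (hP : Function.Injective P)
    (m : ℝ) (hm : 0 ≤ m)
    (phi : EuclideanSpace ℝ (Fin 3) → ℝ)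
    (hphi : phi = fun x => m + ∑ i, 1 / (2 * ‖x - P i‖)) :
    ∃ x : EuclideanSpace ℝ (Fin 3), x ∉ Set.range P ∧ fderiv ℝ phi x = 0 := by
  by_contra! hcon
  have hk0 : (0 : ℝ) < k := by exact_mod_cast (by omega : 0 < k)
  let i0 : Fin k := ⟨0, by omega⟩
  let i1 : Fin k := ⟨1, by omega⟩
  have hi : i1 ≠ i0 := by simp [i0, i1]
  -- numerator and denominator
  set N : EuclideanSpace ℝ (Fin 3) → ℝ := fun x => ∏ i, ‖x - P i‖ with hN
  set D : EuclideanSpace ℝ (Fin 3) → ℝ :=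
    fun x => ∑ i, ∏ j ∈ Finset.univ.erase i, ‖x - P j‖ with hD
  have hNc : Continuous N := by fun_prop
  have hDc : Continuous D := by fun_prop
  have hND : ∀ x i, N x = ‖x - P i‖ * ∏ j ∈ Finset.univ.erase i, ‖x - P j‖ := fun x i =>
    (Finset.mul_prod_erase _ _ (Finset.mem_univ i)).symm
  have hnonneg : ∀ x i, 0 ≤ ∏ j ∈ Finset.univ.erase i, ‖x - P j‖ := fun x i =>
    Finset.prod_nonneg fun _ _ => norm_nonneg _
  have hDpos : ∀ x, 0 < D x := by
    intro x
    obtain ⟨i, hix⟩ : ∃ i, ∀ j, j ≠ i → x ≠ P j := by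
      by_cases h : ∃ i, x = P i
      · obtain ⟨i, rfl⟩ := h
        exact ⟨i, fun j hj h => hj (hP h).symm⟩
      · push Not at h
        exact ⟨i0, fun j _ => h j⟩
    refine Finset.sum_pos' (fun i _ => hnonneg x i) ⟨i, Finset.mem_univ i, ?_⟩
    refine Finset.prod_pos fun j hj => norm_pos_iff.2 (sub_ne_zero.2 (hix j (Finset.ne_of_mem_erase hj)))
  set ψ : EuclideanSpace ℝ (Fin 3) → ℝ := fun x => N x / D x with hψ
  have hψc : Continuous ψ := hNc.div hDc fun x => (hDpos x).ne'
  have hψP : ∀ i, ψ (P i) = 0 := fun i => by simp [hψ, hND (P i) i]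
  have hoff : ∀ x, 0 < ψ x → ∀ i, x ≠ P i := by
    rintro x hx i rfl
    rw [hψP i] at hx; exact lt_irrefl _ hx
  have hphiψ : ∀ x, (∀ i, x ≠ P i) → phi x = m + (1 / 2) * (ψ x)⁻¹ := by
    intro x hx
    have hn : ∀ i, ‖x - P i‖ ≠ 0 := fun i => norm_ne_zero_iff.2 (sub_ne_zero.2 (hx i))
    have hN0 : N x ≠ 0 := Finset.prod_ne_zero_iff.2 fun i _ => hn i
    simp only [hphi, hψ, inv_div]
    congr 1
    simp only [hD]
    rw [Finset.sum_div, Finset.mul_sum]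
    refine Finset.sum_congr rfl fun i _ => ?_
    have h2 : ∏ j ∈ Finset.univ.erase i, ‖x - P j‖ ≠ 0 :=
      Finset.prod_ne_zero_iff.2 fun i _ => hn i
    rw [hND x i]
    have := hn i
    field_simp
  have hbound : ∀ x r, ψ x ≤ r / k → ∃ i, x ∈ Metric.closedBall (P i) r := by
    intro x r h
    by_contra! hno
    have h1 : ∀ i, r < ‖x - P i‖ := fun i => by
      have := hno i
      rw [Metric.mem_closedBall, dist_eq_norm, not_le] at this
      exact this
    have h2 : r * D x < k * N x := by
      have e1 : (k : ℝ) * N x = ∑ i : Fin k, N x := by simp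
      rw [e1]
      simp only [hD]
      rw [Finset.mul_sum]
      obtain ⟨i, -, hi⟩ := Finset.exists_lt_of_sum_lt (s := Finset.univ)
        (f := fun _ : Fin k => (0 : ℝ))
        (g := fun i => ∏ j ∈ Finset.univ.erase i, ‖x - P j‖) (by simpa using hDpos x)
      refine Finset.sum_lt_sum (fun i _ => ?_) ⟨i, Finset.mem_univ i, ?_⟩
      · rw [hND x i]; exact mul_le_mul_of_nonneg_right (h1 i).le (hnonneg x i)
      · rw [hND x i]; exact mul_lt_mul_of_pos_right (h1 i) hi
    simp only [hψ] at h
    rw [div_le_div_iff₀ (hDpos x) hk0] at h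
    linarith
  have hK : ∀ M, IsCompact {x | ψ x ≤ M} := by
    intro M
    have hcomp : IsCompact (⋃ i, Metric.closedBall (P i) (M * k)) :=
      isCompact_iUnion fun i => isCompact_closedBall _ _
    refine hcomp.of_isClosed_subset (isClosed_le hψc continuous_const) fun x hx => ?_
    have hx' : ψ x ≤ M * k / k := by rw [mul_div_cancel_right₀ _ hk0.ne']; exact hx
    exact mem_iUnion.2 (hbound x _ hx')
  have hd : ∀ x, 0 < ψ x → ContDiffAt ℝ 1 ψ x := by
    intro x hx
    have hn : ∀ i, ContDiffAt ℝ 1 (fun x => ‖x - P i‖) x := fun i =>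
      (contDiffAt_id.sub contDiffAt_const).norm ℝ (sub_ne_zero.2 (hoff x hx i))
    refine ContDiffAt.div ?_ ?_ (hDpos x).ne'
    · exact contDiffAt_prod fun i _ => hn i
    · exact ContDiffAt.sum fun i _ => contDiffAt_prod fun i _ => hn i
  have hg : ∀ x, 0 < ψ x → gradient ψ x ≠ 0 := by
    intro x hx h0
    have hf : HasFDerivAt ψ (0 : EuclideanSpace ℝ (Fin 3) →L[ℝ] ℝ) x := by
      have := ((hd x hx).differentiableAt (by norm_num)).hasGradientAt.hasFDerivAt
      rw [h0] at this
      simpa using this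
    refine hcon x (fun ⟨i, hix⟩ => hoff x hx i hix.symm) ?_
    have h1 := (((hasDerivAt_inv hx.ne').comp_hasFDerivAt x hf).const_mul (1 / 2)).const_add m
    have h2 : phi =ᶠ[𝓝 x] fun y => m + (1 / 2) * (ψ y)⁻¹ := by
      filter_upwards [hψc.continuousAt.eventually_const_lt hx] with y hy
      exact hphiψ y (hoff y hy)
    have h3 := h1.congr_of_eventuallyEq h2
    rw [h3.fderiv]
    simp
  obtain ⟨r, hr, hr0⟩ : ∃ r : ℝ, (∀ i, i ≠ i0 → 2 * r < dist (P i) (P i0)) ∧ 0 < r := by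
    have h1 : ∀ᶠ r : ℝ in 𝓝[>] 0, ∀ i, i ≠ i0 → 2 * r < dist (P i) (P i0) := by
      refine eventually_all.2 fun i => ?_
      by_cases h : i = i0
      · simp [h]
      · have hp : 0 < dist (P i) (P i0) := dist_pos.2 fun e => h (hP e)
        have : ∀ᶠ r : ℝ in 𝓝 0, 2 * r < dist (P i) (P i0) := by
          have hcont : ContinuousAt (fun r : ℝ => 2 * r) 0 := by fun_prop
          exact hcont.eventually_lt_const (by simpa using hp)
        exact (this.filter_mono nhdsWithin_le_nhds).mono fun _ h _ => h
    exact (h1.and self_mem_nhdsWithin).exists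
  obtain ⟨C, hC, haC, hbC, hle⟩ := mp_connected hψc hK hd hg (hψP i0).le (hψP i1).le
    (div_pos hr0 hk0)
  have hB : IsClosed (⋃ i : {i // i ≠ i0}, Metric.closedBall (P i) r) :=
    isClosed_iUnion_of_finite fun i => Metric.isClosed_closedBall
  have hmem : ∀ i, P i ∈ Metric.closedBall (P i) r := fun i =>
    Metric.mem_closedBall_self hr0.le
  obtain ⟨z, -, hz0, hz1⟩ := isPreconnected_closed_iff.1 hC _ _
    (Metric.isClosed_closedBall (x := P i0) (ε := r)) hB (fun x hx => by
      obtain ⟨i, hi⟩ := hbound x r (hle x hx)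
      by_cases h : i = i0
      · left; rw [← h]; exact hi
      · right; exact mem_iUnion.2 ⟨⟨i, h⟩, hi⟩)
    ⟨P i0, haC, hmem i0⟩ ⟨P i1, hbC, mem_iUnion.2 ⟨⟨i1, hi⟩, hmem i1⟩⟩
  obtain ⟨⟨i, hne⟩, hzi⟩ := mem_iUnion.1 hz1
  have h1 := hr i hne
  have h2 := dist_triangle_left (P i) (P i0) z
  rw [Metric.mem_closedBall] at hz0 hzi
  simp only at hzi
  linarith
end

section
/- Let k ≥ 2, let z₁ < z₂ < … < z_k be real numbers, set Pᵢ = (0, 0, zᵢ) ∈ ℝ³, let m ≥ 0, and define φ : ℝ³ \ {P₁, …, P_k} → ℝ by φ(x) = m + Σ_{i=1}^{k} 1/(2‖x − Pᵢ‖). Then φ has exactly k − 1 critical points; each of them lies on the z-axis, and for each i ∈ {1, …, k−1} there is exactly one critical point of the form (0, 0, z) with zᵢ < z < zᵢ₊₁. -/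
open Filter Topology Set

/-- Derivative of one summand of the potential. -/
lemma cc_hasFDerivAt_term (x p : EuclideanSpace ℝ (Fin 3)) (h : x ≠ p) :
    HasFDerivAt (fun y : EuclideanSpace ℝ (Fin 3) => 1 / (2 * ‖y - p‖))
      (innerSL ℝ ((-(1 / (2 * ‖x - p‖ ^ 3))) • (x - p))) x := by
  have hn : 0 < ‖x - p‖ := norm_pos_iff.mpr (sub_ne_zero.mpr h)
  have h1 : HasFDerivAt (fun y : EuclideanSpace ℝ (Fin 3) => ‖y - p‖ ^ 2)
      (2 • (innerSL ℝ (x - p))) x := by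
    have := ((hasFDerivAt_id x).sub_const p).norm_sq
    simpa using this
  have h2 := h1.sqrt (by positivity)
  have h3 : HasFDerivAt (fun y : EuclideanSpace ℝ (Fin 3) => ‖y - p‖)
      ((1 / ‖x - p‖) • innerSL ℝ (x - p)) x := by
    have e : (fun y : EuclideanSpace ℝ (Fin 3) => √(‖y - p‖ ^ 2)) = fun y => ‖y - p‖ := by
      funext y; exact Real.sqrt_sq (norm_nonneg _)
    rw [e] at h2
    refine h2.congr_fderiv ?_
    ext v
    simp [Real.sqrt_sq (norm_nonneg _)]
    field_simp
  have h4 := (hasDerivAt_inv (ne_of_gt (by positivity : 0 < 2 * ‖x - p‖))).comp_hasFDerivAt x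
    (h3.const_mul 2)
  have e : ((fun y : ℝ => y⁻¹) ∘ fun y : EuclideanSpace ℝ (Fin 3) => 2 * ‖y - p‖)
      = fun y => 1 / (2 * ‖y - p‖) := by
    funext y; simp
  change HasFDerivAt ((fun y : ℝ => y⁻¹) ∘ fun y : EuclideanSpace ℝ (Fin 3) => 2 * ‖y - p‖) _ _ at h4
  rw [e] at h4
  refine h4.congr_fderiv ?_
  ext v
  simp only [ContinuousLinearMap.smul_apply, innerSL_apply_apply, inner_smul_left, smul_eq_mul]
  simp
  field_simp
  try ring

/-- The one-dimensional force. -/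
noncomputable def ccForce (u : ℝ) : ℝ := u / |u| ^ 3

lemma ccForce_pos {u : ℝ} (h : 0 < u) : 0 < ccForce u := by
  unfold ccForce; positivity

lemma ccForce_neg (u : ℝ) : ccForce (-u) = - ccForce u := by
  unfold ccForce; rw [abs_neg, neg_div]

lemma ccForce_of_pos {u : ℝ} (h : 0 < u) : ccForce u = (u ^ 2)⁻¹ := by
  unfold ccForce; rw [abs_of_pos h]; field_simp

lemma ccForce_lt {u v : ℝ} (hu : 0 < u) (h : u < v) : ccForce v < ccForce u := by
  rw [ccForce_of_pos hu, ccForce_of_pos (hu.trans h)]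
  gcongr

lemma ccForce_lt_neg {u v : ℝ} (hv : v < 0) (h : u < v) : ccForce v < ccForce u := by
  have := ccForce_lt (u := -v) (v := -u) (by linarith) (by linarith)
  rw [ccForce_neg, ccForce_neg] at this
  linarith

lemma ccForce_continuousAt {u : ℝ} (h : u ≠ 0) : ContinuousAt ccForce u := by
  unfold ccForce
  exact continuousAt_id.div (by fun_prop) (by positivity)

lemma ccForce_tendsto_right : Tendsto ccForce (𝓝[>] 0) atTop := by
  have : Tendsto (fun u : ℝ => (u ^ 2)⁻¹) (𝓝[>] 0) atTop := by
    apply tendsto_inv_nhdsGT_zero.comp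
    rw [tendsto_nhdsWithin_iff]
    constructor
    · have : ContinuousAt (fun u : ℝ => u ^ 2) 0 := by fun_prop
      have h := this.tendsto
      simp only [ne_eq, OfNat.ofNat_ne_zero, not_false_eq_true, zero_pow] at h
      exact h.mono_left nhdsWithin_le_nhds
    · filter_upwards [self_mem_nhdsWithin] with u hu
      have : (0:ℝ) < u := hu
      exact pow_pos this 2
  refine this.congr' ?_
  filter_upwards [self_mem_nhdsWithin] with u hu
  exact (ccForce_of_pos hu).symm

lemma ccForce_tendsto_left : Tendsto ccForce (𝓝[<] 0) atBot := by
  have h : Tendsto (fun u : ℝ => -u) (𝓝[<] 0) (𝓝[>] 0) := by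
    have := tendsto_neg_nhdsLT (a := (0:ℝ))
    simpa using this
  have h2 := tendsto_neg_atTop_atBot.comp (ccForce_tendsto_right.comp h)
  refine h2.congr ?_
  intro u
  simp [ccForce_neg]

noncomputable def ccG {k : ℕ} (z : Fin k → ℝ) (t : ℝ) : ℝ := ∑ i, ccForce (t - z i)

lemma ccG_tendsto_right {k : ℕ} (z : Fin k → ℝ) (hz : StrictMono z) (i : Fin k) :
    Tendsto (ccG z) (𝓝[>] (z i)) atTop := by
  have e : ccG z = fun t => ccForce (t - z i) + ∑ j ∈ Finset.univ.erase i, ccForce (t - z j) := by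
    funext t; unfold ccG; rw [Finset.add_sum_erase _ (fun j => ccForce (t - z j)) (Finset.mem_univ i)]
  rw [e]
  refine Tendsto.atTop_add (C := ∑ j ∈ Finset.univ.erase i, ccForce (z i - z j)) ?_ ?_
  · apply ccForce_tendsto_right.comp
    rw [tendsto_nhdsWithin_iff]
    constructor
    · have : ContinuousAt (fun t : ℝ => t - z i) (z i) := by fun_prop
      have h := this.tendsto
      simp only [sub_self] at h
      exact h.mono_left nhdsWithin_le_nhds
    · filter_upwards [self_mem_nhdsWithin] with u hu
      exact sub_pos.mpr (mem_Ioi.mp hu)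
  · apply tendsto_finsetSum
    intro j hj
    have hne : z i - z j ≠ 0 := sub_ne_zero.mpr (fun h => (Finset.ne_of_mem_erase hj) (hz.injective h).symm)
    have : ContinuousAt (fun t : ℝ => ccForce (t - z j)) (z i) :=
      ContinuousAt.comp (f := fun t : ℝ => t - z j) (ccForce_continuousAt hne) (by fun_prop)
    exact this.tendsto.mono_left nhdsWithin_le_nhds

lemma ccG_tendsto_left {k : ℕ} (z : Fin k → ℝ) (hz : StrictMono z) (i : Fin k) :
    Tendsto (ccG z) (𝓝[<] (z i)) atBot := by
  have e : ccG z = fun t => ccForce (t - z i) + ∑ j ∈ Finset.univ.erase i, ccForce (t - z j) := by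
    funext t; unfold ccG; rw [Finset.add_sum_erase _ (fun j => ccForce (t - z j)) (Finset.mem_univ i)]
  rw [e]
  refine Tendsto.atBot_add (C := ∑ j ∈ Finset.univ.erase i, ccForce (z i - z j)) ?_ ?_
  · apply ccForce_tendsto_left.comp
    rw [tendsto_nhdsWithin_iff]
    constructor
    · have : ContinuousAt (fun t : ℝ => t - z i) (z i) := by fun_prop
      have h := this.tendsto
      simp only [sub_self] at h
      exact h.mono_left nhdsWithin_le_nhds
    · filter_upwards [self_mem_nhdsWithin] with u hu
      exact sub_neg.mpr (mem_Iio.mp hu)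
  · apply tendsto_finsetSum
    intro j hj
    have hne : z i - z j ≠ 0 := sub_ne_zero.mpr (fun h => (Finset.ne_of_mem_erase hj) (hz.injective h).symm)
    have : ContinuousAt (fun t : ℝ => ccForce (t - z j)) (z i) :=
      ContinuousAt.comp (f := fun t : ℝ => t - z j) (ccForce_continuousAt hne) (by fun_prop)
    exact this.tendsto.mono_left nhdsWithin_le_nhds

/-- Dichotomy: a charge is either left or right of a whole gap. -/
lemma cc_gap {n : ℕ} (z : Fin (n + 1) → ℝ) (hz : StrictMono z) (i : Fin n) (j : Fin (n + 1)) :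
    z j ≤ z i.castSucc ∨ z i.succ ≤ z j := by
  rcases le_or_gt j i.castSucc with h | h
  · exact Or.inl (hz.monotone h)
  · exact Or.inr (hz.monotone (Fin.castSucc_lt_iff_succ_le.mp h))

lemma ccG_existsUnique {n : ℕ} (z : Fin (n + 1) → ℝ) (hz : StrictMono z) (i : Fin n) :
    ∃! t : ℝ, z i.castSucc < t ∧ t < z i.succ ∧ ccG z t = 0 := by
  have hlt : z i.castSucc < z i.succ := hz Fin.castSucc_lt_succ
  have hanti : ∀ s t, z i.castSucc < s → s < t → t < z i.succ → ccG z t < ccG z s := by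
    intro s t hs hst ht
    unfold ccG
    apply Finset.sum_lt_sum_of_nonempty ⟨i.succ, Finset.mem_univ _⟩
    intro j _
    rcases cc_gap z hz i j with h | h
    · exact ccForce_lt (by linarith) (by linarith)
    · exact ccForce_lt_neg (by linarith) (by linarith)
  have hcont : ContinuousOn (ccG z) (Ioo (z i.castSucc) (z i.succ)) := by
    intro t ht
    apply ContinuousAt.continuousWithinAt
    unfold ccG
    apply tendsto_finsetSum
    intro j _
    have hne : t - z j ≠ 0 := by
      rcases cc_gap z hz i j with h | h
      · exact ne_of_gt (by linarith [ht.1])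
      · exact ne_of_lt (by linarith [ht.2])
    exact ContinuousAt.comp (f := fun t : ℝ => t - z j) (ccForce_continuousAt hne) (by fun_prop)
  have hiv := isPreconnected_Ioo.intermediate_value_Iii (l₁ := 𝓝[<] (z i.succ))
    (l₂ := 𝓝[>] (z i.castSucc)) (s := Ioo (z i.castSucc) (z i.succ))
    (le_principal_iff.mpr (Ioo_mem_nhdsLT hlt)) (le_principal_iff.mpr (Ioo_mem_nhdsGT hlt)) hcont
    (ccG_tendsto_left z hz _) (ccG_tendsto_right z hz _)
  obtain ⟨t, ht, h0⟩ := hiv (mem_univ 0)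
  refine ⟨t, ⟨ht.1, ht.2, h0⟩, ?_⟩
  rintro s ⟨hs1, hs2, hs0⟩
  rcases lt_trichotomy s t with h | h | h
  · have := hanti s t hs1 h ht.2; linarith
  · exact h
  · have := hanti t s ht.1 h hs2; linarith

lemma ccG_locate {n : ℕ} (z : Fin (n + 1) → ℝ) (hz : StrictMono z) (t : ℝ)
    (hne : ∀ i, t ≠ z i) (h0 : ccG z t = 0) : ∃ i : Fin n, z i.castSucc < t ∧ t < z i.succ := by
  by_contra! hcon
  have hnx : ∀ i : Fin n, z i.castSucc < t → z i.succ < t := fun i hi =>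
    lt_of_le_of_ne (hcon i hi) (hne _).symm
  rcases lt_or_gt_of_ne (hne 0) with h | h
  · have : 0 < ∑ i, - ccForce (t - z i) := by
      apply Finset.sum_pos _ ⟨0, Finset.mem_univ _⟩
      intro j _
      rw [← ccForce_neg]
      exact ccForce_pos (by linarith [hz.monotone (Fin.zero_le j)])
    rw [Finset.sum_neg_distrib] at this
    unfold ccG at h0
    linarith
  · have hall : ∀ j, z j < t := by
      intro j
      induction j using Fin.induction with
      | zero => exact h
      | succ i ih => exact hnx i ih
    have : 0 < ∑ i, ccForce (t - z i) := by
      apply Finset.sum_pos _ ⟨0, Finset.mem_univ _⟩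
      intro j _
      exact ccForce_pos (by linarith [hall j])
    unfold ccG at h0
    linarith

/-- Characterisation of critical points. -/
lemma cc_crit_iff {n : ℕ} (z : Fin (n + 1) → ℝ) (m : ℝ)
    (P : Fin (n + 1) → EuclideanSpace ℝ (Fin 3))
    (hP : ∀ i, P i = EuclideanSpace.single 2 (z i))
    (x : EuclideanSpace ℝ (Fin 3)) :
    (x ∉ Set.range P ∧
      fderiv ℝ (fun x => m + ∑ i, 1 / (2 * ‖x - P i‖) : EuclideanSpace ℝ (Fin 3) → ℝ) x = 0) ↔
    ∃ t : ℝ, x = EuclideanSpace.single 2 t ∧ (∀ i, t ≠ z i) ∧ ccG z t = 0 := by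
  have key : x ∉ Set.range P →
      (fderiv ℝ (fun x => m + ∑ i, 1 / (2 * ‖x - P i‖) : EuclideanSpace ℝ (Fin 3) → ℝ) x = 0 ↔
        ∀ c, ∑ i, (1 / ‖x - P i‖ ^ 3) * (x c - P i c) = 0) := by
    intro hx
    have hd := (HasFDerivAt.fun_sum (u := Finset.univ) (fun i _ => cc_hasFDerivAt_term x (P i)
      (fun h => hx ⟨i, h.symm⟩))).const_add m
    have hinj : ∀ v : EuclideanSpace ℝ (Fin 3), innerSL ℝ v = 0 ↔ v = 0 := by
      intro v
      rw [← norm_eq_zero, innerSL_apply_norm, norm_eq_zero]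
    rw [hd.fderiv, ← map_sum, hinj, PiLp.ext_iff]
    refine forall_congr' fun c => ?_
    have e : (∑ i, (-(1 / (2 * ‖x - P i‖ ^ 3))) • (x - P i)) c
        = -(1 / 2) * ∑ i, (1 / ‖x - P i‖ ^ 3) * (x c - P i c) := by
      rw [Finset.mul_sum]
      simp
      refine Finset.sum_congr rfl fun i _ => ?_
      ring
    rw [e]
    simp
  have axis : ∀ t, x = EuclideanSpace.single 2 t → ∀ i, ‖x - P i‖ = |t - z i| := by
    rintro t rfl i
    have e : (EuclideanSpace.single 2 t - P i : EuclideanSpace ℝ (Fin 3))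
        = EuclideanSpace.single 2 (t - z i) := by
      rw [hP]
      ext c
      by_cases h : c = 2
      · subst h; simp
      · simp [h]
    rw [e]
    simp
  have rng : ∀ t, x = EuclideanSpace.single 2 t → (x ∉ Set.range P ↔ ∀ i, t ≠ z i) := by
    intro t ht
    simp only [Set.mem_range, not_exists]
    refine forall_congr' fun i => not_congr ?_
    rw [eq_comm, ← sub_eq_zero, ← norm_eq_zero, axis t ht i, abs_eq_zero, sub_eq_zero]
  have sumeq : ∀ t, x = EuclideanSpace.single 2 t →
      ∑ i, (1 / ‖x - P i‖ ^ 3) * (x 2 - P i 2) = ccG z t := by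
    intro t ht
    unfold ccG ccForce
    refine Finset.sum_congr rfl fun i _ => ?_
    rw [axis t ht i, hP, ht]
    simp
    ring
  constructor
  · rintro ⟨hx, hf⟩
    have hc := (key hx).mp hf
    have hS : 0 < ∑ i, 1 / ‖x - P i‖ ^ 3 := by
      apply Finset.sum_pos _ ⟨0, Finset.mem_univ _⟩
      intro i _
      have : 0 < ‖x - P i‖ := norm_pos_iff.mpr (sub_ne_zero.mpr fun h => hx ⟨i, h.symm⟩)
      positivity
    have hz0 : ∀ c : Fin 3, c ≠ 2 → x c = 0 := by
      intro c hc2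
      have h := hc c
      have e : ∀ i, P i c = 0 := by intro i; rw [hP]; simp [hc2]
      simp only [e, sub_zero] at h
      rw [← Finset.sum_mul] at h
      exact (mul_eq_zero.mp h).resolve_left hS.ne'
    have hxt : x = EuclideanSpace.single 2 (x 2) := by
      ext c
      by_cases h : c = 2
      · subst h; simp
      · simp [h, hz0 c h]
    refine ⟨x 2, hxt, (rng _ hxt).mp hx, ?_⟩
    rw [← sumeq _ hxt]
    exact hc 2
  · rintro ⟨t, ht, hne, h0⟩
    have hx := (rng t ht).mpr hne
    refine ⟨hx, (key hx).mpr fun c => ?_⟩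
    by_cases h : c = 2
    · subst h; rw [sumeq t ht, h0]
    · apply Finset.sum_eq_zero
      intro i _
      rw [hP, ht]
      simp [h]

/-- For `k ≥ 2` collinear unit charges at `Pᵢ = (0,0,zᵢ)` with `z₁ < ⋯ < z_k`,
the potential `φ(x) = m + Σᵢ 1/(2‖x − Pᵢ‖)` has exactly `k − 1` critical
points; all lie on the `z`-axis, with exactly one strictly between each pair
of consecutive charges. -/
theorem collinear_charges_critical_points
    {k : ℕ} (hk : 2 ≤ k) (z : Fin k → ℝ) (hz : StrictMono z)
    (m : ℝ) (hm : 0 ≤ m)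
    (P : Fin k → EuclideanSpace ℝ (Fin 3))
    (hP : ∀ i, P i = EuclideanSpace.single 2 (z i))
    (phi : EuclideanSpace ℝ (Fin 3) → ℝ)
    (hphi : phi = fun x => m + ∑ i, 1 / (2 * ‖x - P i‖)) :
    let C := {x : EuclideanSpace ℝ (Fin 3) | x ∉ Set.range P ∧ fderiv ℝ phi x = 0}
    C.ncard = k - 1 ∧
    (∀ x ∈ C, x 0 = 0 ∧ x 1 = 0) ∧
    (∀ i : Fin k, ∀ h : (i : ℕ) + 1 < k,
      ∃! t : ℝ, z i < t ∧ t < z ⟨(i : ℕ) + 1, h⟩ ∧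
        EuclideanSpace.single 2 t ∈ C) := by
  intro C
  obtain ⟨n, rfl⟩ : ∃ n, k = n + 1 := ⟨k - 1, by omega⟩
  have hC : ∀ x, x ∈ C ↔ ∃ t : ℝ, x = EuclideanSpace.single 2 t ∧ (∀ i, t ≠ z i) ∧ ccG z t = 0 := by
    intro x
    rw [← cc_crit_iff z m P hP x, ← hphi]
    rfl
  have hsinj : ∀ s t : ℝ, (EuclideanSpace.single 2 s : EuclideanSpace ℝ (Fin 3))
      = EuclideanSpace.single 2 t → s = t := by
    intro s t h
    have := congrArg (fun v : EuclideanSpace ℝ (Fin 3) => v 2) h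
    simpa using this
  have hC' : ∀ t : ℝ, (EuclideanSpace.single 2 t : EuclideanSpace ℝ (Fin 3)) ∈ C ↔
      (∀ i, t ≠ z i) ∧ ccG z t = 0 := by
    intro t
    rw [hC]
    constructor
    · rintro ⟨s, hs, h⟩
      rw [hsinj _ _ hs]; exact h
    · intro h; exact ⟨t, rfl, h⟩
  have hgapne : ∀ (i : Fin n) (t : ℝ), z i.castSucc < t → t < z i.succ → ∀ j, t ≠ z j := by
    intro i t h1 h2 j
    rcases cc_gap z hz i j with h | h
    · exact ne_of_gt (by linarith)
    · exact ne_of_lt (by linarith)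
  refine ⟨?_, ?_, ?_⟩
  · choose f hf hu using ccG_existsUnique z hz
    have hr : C = Set.range (fun i => (EuclideanSpace.single 2 (f i) : EuclideanSpace ℝ (Fin 3))) := by
      ext x
      constructor
      · intro hx
        obtain ⟨t, rfl, hne, h0⟩ := (hC x).mp hx
        obtain ⟨i, h1, h2⟩ := ccG_locate z hz t hne h0
        refine ⟨i, ?_⟩
        simp only
        rw [hu i t ⟨h1, h2, h0⟩]
      · rintro ⟨i, rfl⟩
        exact (hC' _).mpr ⟨hgapne i _ (hf i).1 (hf i).2.1, (hf i).2.2⟩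
    have hfm : StrictMono f := by
      intro i j hij
      have : z i.succ ≤ z j.castSucc := hz.monotone (by
        rw [← Fin.castSucc_lt_iff_succ_le]; exact hij)
      linarith [(hf i).2.1, (hf j).1]
    rw [hr, ← Set.image_univ, Set.ncard_image_of_injective _
      (fun i j h => hfm.injective (hsinj _ _ h)), Set.ncard_univ]
    simp
  · intro x hx
    obtain ⟨t, rfl, -⟩ := (hC x).mp hx
    simp
  · intro i h
    obtain ⟨t, ⟨h1, h2, h0⟩, hu⟩ := ccG_existsUnique z hz ⟨i, by omega⟩
    refine ⟨t, ⟨h1, h2, (hC' t).mpr ⟨hgapne _ t h1 h2, h0⟩⟩, ?_⟩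
    rintro s ⟨h1', h2', h3'⟩
    exact hu s ⟨h1', h2', ((hC' s).mp h3').2⟩
end

section
/- Let P₁, P₂, P₃ ∈ ℝ³ be the vertices of an equilateral triangle, let m ≥ 0, and define φ : ℝ³ \ {P₁, P₂, P₃} → ℝ by φ(x) = m + Σ_{i=1}^{3} 1/(2‖x − Pᵢ‖). Then φ has exactly 4 critical points, all of them nondegenerate and lying in the plane of the triangle: three critical points of Morse index 2, and one critical point of Morse index 1 located at the centroid of the triangle. -/
noncomputable section

/-- The Hessian of `phi` at `x`, as a bilinear form. -/
def hessianForm (phi : EuclideanSpace ℝ (Fin 3) → ℝ)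
    (x u v : EuclideanSpace ℝ (Fin 3)) : ℝ :=
  iteratedFDeriv ℝ 2 phi x ![u, v]

/-- A critical point is nondegenerate if its Hessian form is nondegenerate. -/
def IsNondegenerateCrit (phi : EuclideanSpace ℝ (Fin 3) → ℝ)
    (x : EuclideanSpace ℝ (Fin 3)) : Prop :=
  ∀ u : EuclideanSpace ℝ (Fin 3), (∀ v, hessianForm phi x u v = 0) → u = 0

/-- The Morse index of `phi` at `x` is `n`: the Hessian is negative definite
on an `n`-dimensional subspace and positive definite on a complementary
`(3-n)`-dimensional subspace. -/
def HasMorseIndex (phi : EuclideanSpace ℝ (Fin 3) → ℝ)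
    (x : EuclideanSpace ℝ (Fin 3)) (n : ℕ) : Prop :=
  (∃ W : Submodule ℝ (EuclideanSpace ℝ (Fin 3)), Module.finrank ℝ W = n ∧
    ∀ u ∈ W, u ≠ 0 → hessianForm phi x u u < 0) ∧
  (∃ W : Submodule ℝ (EuclideanSpace ℝ (Fin 3)), Module.finrank ℝ W = 3 - n ∧
    ∀ u ∈ W, u ≠ 0 → 0 < hessianForm phi x u u)


abbrev E3 := EuclideanSpace ℝ (Fin 3)

/-- the inner product as a bilinear map -/
def ip : E3 →L[ℝ] E3 →L[ℝ] ℝ := innerSL ℝ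

lemma ip_apply (u v : E3) : ip u v = inner ℝ u v := rfl

lemma hasFDerivAt_norm_sub (p x : E3) (h : x ≠ p) :
    HasFDerivAt (fun y : E3 => ‖y - p‖) (‖x - p‖⁻¹ • ip (x - p)) x := by
  have hx : 0 < ‖x - p‖ := norm_pos_iff.2 (sub_ne_zero.2 h)
  have h1 : HasFDerivAt (fun y : E3 => y - p) (ContinuousLinearMap.id ℝ E3) x :=
    (hasFDerivAt_id x).sub_const p
  have h2 := h1.norm_sq
  have h3 := h2.sqrt (by positivity)
  have h4 : (fun y : E3 => √(‖y - p‖ ^ 2)) = fun y : E3 => ‖y - p‖ := by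
    funext y
    exact Real.sqrt_sq (norm_nonneg _)
  rw [h4, Real.sqrt_sq hx.le] at h3
  refine h3.congr_fderiv ?_
  refine ContinuousLinearMap.ext fun v => ?_
  simp [ip_apply]
  field_simp

lemma hasFDerivAt_charge (p x : E3) (h : x ≠ p) :
    HasFDerivAt (fun y : E3 => 1 / (2 * ‖y - p‖))
      ((-(1 / 2) * (‖x - p‖⁻¹) ^ 3) • ip (x - p)) x := by
  have hx : 0 < ‖x - p‖ := norm_pos_iff.2 (sub_ne_zero.2 h)
  have h1 := hasFDerivAt_norm_sub p x h
  have h2 : HasDerivAt (fun t : ℝ => 1 / (2 * t)) (-(1 / 2) * (‖x - p‖⁻¹) ^ 2) ‖x - p‖ := by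
    have := ((hasDerivAt_inv hx.ne').const_mul (1 / 2 : ℝ))
    have he : (fun t : ℝ => 1 / (2 * t)) = fun y => 1 / 2 * y⁻¹ := by
      funext t
      simp [mul_comm]
    rw [he]
    refine this.congr_deriv ?_
    simp
  refine (h2.comp_hasFDerivAt x h1).congr_fderiv ?_
  rw [smul_smul]
  congr 1
  ring

lemma hasFDerivAt_grad (p x : E3) (h : x ≠ p) :
    HasFDerivAt (fun y : E3 => (-(1 / 2) * (‖y - p‖⁻¹) ^ 3) • ip (y - p))
      ((-(1 / 2) * (‖x - p‖⁻¹) ^ 3) • ip +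
        (((3 / 2) * (‖x - p‖⁻¹) ^ 5) • ip (x - p)).smulRight (ip (x - p))) x := by
  have hx : 0 < ‖x - p‖ := norm_pos_iff.2 (sub_ne_zero.2 h)
  have h1 := hasFDerivAt_norm_sub p x h
  have h2 : HasDerivAt (fun t : ℝ => -(1 / 2) * (t⁻¹) ^ 3)
      ((3 / 2) * (‖x - p‖⁻¹) ^ 4) ‖x - p‖ := by
    have := ((hasDerivAt_inv hx.ne').fun_pow 3).const_mul (-(1 / 2) : ℝ)
    refine this.congr_deriv ?_
    norm_num
    field_simp
    try norm_num
  have h3 := h2.comp_hasFDerivAt x h1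
  have h4 : HasFDerivAt (fun y : E3 => y - p) (ContinuousLinearMap.id ℝ E3) x :=
    (hasFDerivAt_id x).sub_const p
  have h5 : HasFDerivAt (fun y : E3 => ip (y - p)) ip x := 
    (ip.hasFDerivAt.comp x h4)
  refine (h3.smul h5).congr_fderiv ?_
  refine ContinuousLinearMap.ext fun u => ContinuousLinearMap.ext fun v => ?_
  simp
  left
  ring

/-- the potential of three charges -/
def pot (m : ℝ) (A B C : E3) : E3 → ℝ := fun x =>
  m + (1 / (2 * ‖x - A‖) + 1 / (2 * ‖x - B‖) + 1 / (2 * ‖x - C‖))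

lemma hasFDerivAt_pot (m : ℝ) (A B C x : E3) (hA : x ≠ A) (hB : x ≠ B) (hC : x ≠ C) :
    HasFDerivAt (pot m A B C)
      ((-(1 / 2) * (‖x - A‖⁻¹) ^ 3) • ip (x - A) +
       (-(1 / 2) * (‖x - B‖⁻¹) ^ 3) • ip (x - B) +
       (-(1 / 2) * (‖x - C‖⁻¹) ^ 3) • ip (x - C)) x :=
  (((hasFDerivAt_charge A x hA).add (hasFDerivAt_charge B x hB)).add
    (hasFDerivAt_charge C x hC)).const_add m

lemma fderiv_pot_eq_zero_iff (m : ℝ) (A B C x : E3) (hA : x ≠ A) (hB : x ≠ B) (hC : x ≠ C) :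
    fderiv ℝ (pot m A B C) x = 0 ↔
      ((‖x - A‖⁻¹) ^ 3) • (x - A) + ((‖x - B‖⁻¹) ^ 3) • (x - B) +
        ((‖x - C‖⁻¹) ^ 3) • (x - C) = 0 := by
  rw [(hasFDerivAt_pot m A B C x hA hB hC).fderiv]
  have key : ((-(1 / 2) * (‖x - A‖⁻¹) ^ 3) • ip (x - A) +
       (-(1 / 2) * (‖x - B‖⁻¹) ^ 3) • ip (x - B) +
       (-(1 / 2) * (‖x - C‖⁻¹) ^ 3) • ip (x - C)) =
      ip ((-(1 / 2) : ℝ) • (((‖x - A‖⁻¹) ^ 3) • (x - A) + ((‖x - B‖⁻¹) ^ 3) • (x - B) +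
        ((‖x - C‖⁻¹) ^ 3) • (x - C))) := by
    rw [map_smul, map_add, map_add, map_smul, map_smul, map_smul, smul_add, smul_add,
      smul_smul, smul_smul, smul_smul]
  rw [key]
  constructor
  · intro h
    have h2 := (show ‖ip _‖ = _ from innerSL_apply_norm ℝ (E := E3) _).symm.trans (congrArg norm h)
    rw [norm_zero, norm_eq_zero] at h2
    exact (smul_eq_zero.1 h2).resolve_left (by norm_num)
  · intro h
    rw [h, smul_zero, map_zero]

lemma fderiv2_pot (m : ℝ) (A B C x : E3) (hA : x ≠ A) (hB : x ≠ B) (hC : x ≠ C) (u v : E3) :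
    fderiv ℝ (fderiv ℝ (pot m A B C)) x u v =
      (1 / 2) * (
      (3 * (‖x - A‖⁻¹) ^ 5 * inner ℝ u (x - A) * inner ℝ v (x - A)
        - (‖x - A‖⁻¹) ^ 3 * inner ℝ u v) +
      (3 * (‖x - B‖⁻¹) ^ 5 * inner ℝ u (x - B) * inner ℝ v (x - B)
        - (‖x - B‖⁻¹) ^ 3 * inner ℝ u v) +
      (3 * (‖x - C‖⁻¹) ^ 5 * inner ℝ u (x - C) * inner ℝ v (x - C)
        - (‖x - C‖⁻¹) ^ 3 * inner ℝ u v)) := by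
  have hev : (fderiv ℝ (pot m A B C)) =ᶠ[nhds x] fun x =>
      ((-(1 / 2) * (‖x - A‖⁻¹) ^ 3) • ip (x - A) +
       (-(1 / 2) * (‖x - B‖⁻¹) ^ 3) • ip (x - B) +
       (-(1 / 2) * (‖x - C‖⁻¹) ^ 3) • ip (x - C)) := by
    filter_upwards [isOpen_ne.mem_nhds hA, isOpen_ne.mem_nhds hB, isOpen_ne.mem_nhds hC]
      with y h1 h2 h3
    exact (hasFDerivAt_pot m A B C y h1 h2 h3).fderiv
  rw [hev.fderiv_eq]
  have := ((hasFDerivAt_grad A x hA).add (hasFDerivAt_grad B x hB)).add (hasFDerivAt_grad C x hC)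
  have h2 := this.fderiv
  simp only [Pi.add_def] at h2
  rw [h2]
  simp only [add_apply, smul_apply, ContinuousLinearMap.smulRight_apply, ip_apply,
    smul_eq_mul, real_inner_comm u (x - _), real_inner_comm v (x - _)]
  ring

lemma hessianForm_eq (phi : E3 → ℝ) (x u v : E3) :
    hessianForm phi x u v = fderiv ℝ (fderiv ℝ phi) x u v := by
  simp [hessianForm, iteratedFDeriv_two_apply]

lemma linInd3 (e f n : E3) (he : e ≠ 0) (hf : f ≠ 0) (hn : n ≠ 0)
    (hef : inner ℝ e f = 0) (hen : inner ℝ e n = 0) (hfn : inner ℝ f n = 0) :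
    LinearIndependent ℝ ![e, f, n] := by
  apply linearIndependent_of_ne_zero_of_inner_eq_zero (𝕜 := ℝ)
  · intro i
    fin_cases i <;> simpa
  · intro i j hij
    fin_cases i <;> fin_cases j <;>
      simp_all [real_inner_comm e f, real_inner_comm e n, real_inner_comm f n]

lemma linInd2 (e n : E3) (he : e ≠ 0) (hn : n ≠ 0)
    (hen : inner ℝ e n = 0) : LinearIndependent ℝ ![e, n] := by
  apply linearIndependent_of_ne_zero_of_inner_eq_zero (𝕜 := ℝ)
  · intro i
    fin_cases i <;> simpa
  · intro i j hij
    fin_cases i <;> fin_cases j <;>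
      simp_all [real_inner_comm e n]

lemma exists_coords (e f n : E3) (he : e ≠ 0) (hf : f ≠ 0) (hn : n ≠ 0)
    (hef : inner ℝ e f = 0) (hen : inner ℝ e n = 0) (hfn : inner ℝ f n = 0) (u : E3) :
    ∃ a b c : ℝ, u = a • e + b • f + c • n := by
  have h := (linInd3 e f n he hf hn hef hen hfn).span_eq_top_of_card_eq_finrank (by simp)
  have hu : u ∈ Submodule.span ℝ (Set.range ![e, f, n]) := by rw [h]; trivial
  rw [Submodule.mem_span_range_iff_exists_fun] at hu
  obtain ⟨c, hc⟩ := hu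
  refine ⟨c 0, c 1, c 2, ?_⟩
  rw [← hc]
  simp [Fin.sum_univ_three]

lemma nondeg_of_diag (phi : E3 → ℝ) (x e f n : E3) (he : e ≠ 0) (hf : f ≠ 0) (hn : n ≠ 0)
    (hef : inner ℝ e f = 0) (hen : inner ℝ e n = 0) (hfn : inner ℝ f n = 0)
    (L : E3 →L[ℝ] E3 →L[ℝ] ℝ) (hL : fderiv ℝ (fderiv ℝ phi) x = L)
    (h1 : L e f = 0) (h2 : L f e = 0) (h3 : L e n = 0) (h4 : L n e = 0) (h5 : L f n = 0)
    (h6 : L n f = 0) (hee : L e e ≠ 0) (hff : L f f ≠ 0) (hnn : L n n ≠ 0) :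
    IsNondegenerateCrit phi x := by
  intro u hu
  simp only [hessianForm_eq, hL] at hu
  obtain ⟨a, b, c, rfl⟩ := exists_coords e f n he hf hn hef hen hfn u
  have ha := hu e
  have hb := hu f
  have hc := hu n
  simp [h1, h2, h3, h4, h5, h6, hee, hff, hnn] at ha hb hc
  simp [ha, hb, hc]

lemma def_span_pair (L : E3 →L[ℝ] E3 →L[ℝ] ℝ) (e n : E3) 
    (h3 : L e n = 0) (h4 : L n e = 0) (u : E3) (hu : u ∈ Submodule.span ℝ {e, n}) (hu0 : u ≠ 0) :
    ∃ a b : ℝ, 0 < a ^ 2 + b ^ 2 ∧ L u u = a ^ 2 * L e e + b ^ 2 * L n n := by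
  obtain ⟨a, b, rfl⟩ := Submodule.mem_span_pair.1 hu
  refine ⟨a, b, ?_, ?_⟩
  · by_contra hcon
    have ha : a = 0 := by nlinarith [sq_nonneg a, sq_nonneg b]
    have hb : b = 0 := by nlinarith [sq_nonneg a, sq_nonneg b]
    exact hu0 (by simp [ha, hb])
  · simp [h3, h4]
    ring

lemma finrank_pair (e n : E3) (he : e ≠ 0) (hn : n ≠ 0)
    (hen : inner ℝ e n = 0) : Module.finrank ℝ (Submodule.span ℝ {e, n}) = 2 := by
  have := finrank_span_eq_card (linInd2 e n he hn hen)
  rwa [Matrix.range_cons_cons_empty, Fintype.card_fin] at this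

lemma morse2_of_diag (phi : E3 → ℝ) (x e f n : E3) (he : e ≠ 0) (hf : f ≠ 0) (hn : n ≠ 0)
    (hen : inner ℝ e n = 0) 
    (L : E3 →L[ℝ] E3 →L[ℝ] ℝ) (hL : fderiv ℝ (fderiv ℝ phi) x = L)
    (h3 : L e n = 0) (h4 : L n e = 0) 
    (hee : L e e < 0) (hff : 0 < L f f) (hnn : L n n < 0) :
    HasMorseIndex phi x 2 := by
  refine ⟨⟨Submodule.span ℝ {e, n}, finrank_pair e n he hn hen, ?_⟩,
    ⟨Submodule.span ℝ {f}, finrank_span_singleton hf, ?_⟩⟩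
  · intro u hu hu0
    rw [hessianForm_eq, hL]
    obtain ⟨a, b, hab, h⟩ := def_span_pair L e n h3 h4 u hu hu0
    rw [h]
    rcases (sq_nonneg a).lt_or_eq with h | h
    · nlinarith [sq_nonneg b, mul_neg_of_pos_of_neg h hee]
    · rw [← h] at hab ⊢
      nlinarith
  · intro u hu hu0
    rw [hessianForm_eq, hL]
    obtain ⟨a, rfl⟩ := Submodule.mem_span_singleton.1 hu
    have : a ≠ 0 := by rintro rfl; simp at hu0
    simp
    nlinarith [mul_pos (sq_pos_of_ne_zero this) hff]

lemma morse1_of_diag (phi : E3 → ℝ) (x e f n : E3) (he : e ≠ 0) (hf : f ≠ 0) (hn : n ≠ 0)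
    (hef : inner ℝ e f = 0) 
    (L : E3 →L[ℝ] E3 →L[ℝ] ℝ) (hL : fderiv ℝ (fderiv ℝ phi) x = L)
    (h3 : L e f = 0) (h4 : L f e = 0) 
    (hee : 0 < L e e) (hff : 0 < L f f) (hnn : L n n < 0) :
    HasMorseIndex phi x 1 := by
  refine ⟨⟨Submodule.span ℝ {n}, finrank_span_singleton hn, ?_⟩, 
    ⟨Submodule.span ℝ {e, f}, finrank_pair e f he hf hef, ?_⟩⟩
  · intro u hu hu0
    rw [hessianForm_eq, hL]
    obtain ⟨a, rfl⟩ := Submodule.mem_span_singleton.1 hu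
    have : a ≠ 0 := by rintro rfl; simp at hu0
    simp
    nlinarith [mul_neg_of_pos_of_neg (sq_pos_of_ne_zero this) hnn]
  · intro u hu hu0
    rw [hessianForm_eq, hL]
    obtain ⟨a, b, hab, h⟩ := def_span_pair L e f h3 h4 u hu hu0
    rw [h]
    rcases (sq_nonneg a).lt_or_eq with h | h
    · nlinarith [sq_nonneg b, mul_pos h hee]
    · rw [← h] at hab ⊢
      nlinarith

lemma exists_normal (e f : E3) : ∃ n : E3, n ≠ 0 ∧ inner ℝ e n = 0 ∧ inner ℝ f n = 0 := by
  have h1 : Module.finrank ℝ (Submodule.span ℝ (Set.range ![e, f])) ≤ 2 := by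
    exact finrank_range_le_card (R := ℝ) ![e, f]
  have h2 := Submodule.finrank_add_finrank_orthogonal (Submodule.span ℝ (Set.range ![e, f]))
  have h3 : (Submodule.span ℝ (Set.range ![e, f]))ᗮ ≠ ⊥ := by
    intro h
    rw [h] at h2
    simp only [finrank_bot, finrank_euclideanSpace, Fintype.card_fin] at h2
    omega
  obtain ⟨n, hn, hn0⟩ := Submodule.exists_mem_ne_zero_of_ne_bot h3
  rw [Submodule.mem_orthogonal] at hn
  exact ⟨n, hn0, hn e (Submodule.subset_span ⟨0, rfl⟩), hn f (Submodule.subset_span ⟨1, rfl⟩)⟩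

/-- point on the symmetry axis through the first vertex -/
def axisPt (s : ℝ) (A B C : E3) : E3 := s • A + ((1 - s) / 2) • (B + C)

/-- the sextic whose roots in (0,1) are the critical parameters -/
def sextic (s : ℝ) : ℝ := (1 + 3 * s ^ 2) ^ 3 - 108 * s ^ 2 * (1 - s) ^ 4

/-- cofactor of `1 - 3 s` -/
def quintic (s : ℝ) : ℝ := 1 + 3 * s - 90 * s ^ 2 + 162 * s ^ 3 - 135 * s ^ 4 + 27 * s ^ 5

lemma sextic_eq (s : ℝ) : sextic s = (1 - 3 * s) * quintic s := by
  unfold sextic quintic; ring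

lemma quintic_pos (s : ℝ) (h0 : 0 < s) (h1 : s ≤ 1 / 10) : 0 < quintic s := by
  unfold quintic
  have h2 : s ^ 2 ≤ s * (1 / 10) := by nlinarith
  have h3 : 0 < s ^ 3 := by positivity
  have h4 : s ^ 4 ≤ s ^ 3 * (1 / 10) := by nlinarith
  have h5 : 0 < s ^ 5 := by positivity
  nlinarith

lemma quintic_neg (s : ℝ) (h0 : 1 / 5 ≤ s) (h1 : s < 1) : quintic s < 0 := by
  unfold quintic
  have hs : 0 < s := by linarith
  have h5 : s ^ 5 ≤ s ^ 4 := by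
    have : 0 < s ^ 4 := by positivity
    nlinarith
  rcases le_total s (2 / 5) with h | h
  · have h2 : 1 + 3 * s ≤ 40 * s ^ 2 := by nlinarith
    have h3 : 0 < s ^ 2 * (50 - 162 * s + 108 * s ^ 2) := by
      have : 0 < 50 - 162 * s + 108 * s ^ 2 := by nlinarith
      positivity
    nlinarith
  · have h2 : 1 + 3 * s ≤ (55 / 4) * s ^ 2 := by nlinarith
    have h3 : 0 < s ^ 2 * (305 / 4 - 162 * s + 108 * s ^ 2) := by
      have : 0 < 305 / 4 - 162 * s + 108 * s ^ 2 := by nlinarith [sq_nonneg (s - 3 / 4)]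
      positivity
    nlinarith

lemma quintic_anti (s t : ℝ) (hs : 1 / 10 ≤ s) (hst : s < t) (ht : t ≤ 1 / 5) :
    quintic t < quintic s := by
  have key : quintic t - quintic s = (t - s) * (3 - 90 * (s + t) + 162 * (s ^ 2 + s * t + t ^ 2)
      - 135 * (s ^ 3 + s ^ 2 * t + s * t ^ 2 + t ^ 3)
      + 27 * (s ^ 4 + s ^ 3 * t + s ^ 2 * t ^ 2 + s * t ^ 3 + t ^ 4)) := by
    unfold quintic; ring
  have hs0 : 0 < s := by linarith
  have ht0 : 0 < t := by linarith
  have h2 : s ^ 2 + s * t + t ^ 2 ≤ (s + t) ^ 2 := by nlinarith [mul_pos hs0 ht0]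
  have h3 : 0 < s ^ 3 + s ^ 2 * t + s * t ^ 2 + t ^ 3 := by positivity
  have h4 : s ^ 4 + s ^ 3 * t + s ^ 2 * t ^ 2 + s * t ^ 3 + t ^ 4 ≤ 1 / 10 := by
    have hs1 : s ≤ 1 / 5 := by linarith
    calc s ^ 4 + s ^ 3 * t + s ^ 2 * t ^ 2 + s * t ^ 3 + t ^ 4
        ≤ (1 / 5) ^ 4 + (1 / 5) ^ 3 * (1 / 5) + (1 / 5) ^ 2 * (1 / 5) ^ 2 + (1 / 5) * (1 / 5) ^ 3
          + (1 / 5) ^ 4 := by gcongr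
      _ ≤ 1 / 10 := by norm_num
  have h5 : 3 - 90 * (s + t) + 162 * (s + t) ^ 2 < -5 := by nlinarith
  have : (t - s) * (3 - 90 * (s + t) + 162 * (s ^ 2 + s * t + t ^ 2)
      - 135 * (s ^ 3 + s ^ 2 * t + s * t ^ 2 + t ^ 3)
      + 27 * (s ^ 4 + s ^ 3 * t + s ^ 2 * t ^ 2 + s * t ^ 3 + t ^ 4)) < 0 :=
    mul_neg_of_pos_of_neg (by linarith) (by linarith)
  linarith

lemma exists_root : ∃ s0 : ℝ, 1 / 10 < s0 ∧ s0 < 1 / 5 ∧ sextic s0 = 0 ∧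
    ∀ s : ℝ, 0 < s → s < 1 → sextic s = 0 → s = 1 / 3 ∨ s = s0 := by
  have hcont : ContinuousOn quintic (Set.Icc (1 / 10) (1 / 5)) := by
    unfold quintic; fun_prop
  have h1 := quintic_pos (1 / 10) (by norm_num) le_rfl
  have h2 := quintic_neg (1 / 5) le_rfl (by norm_num)
  obtain ⟨s0, ⟨ha, hb⟩, h0⟩ := intermediate_value_Icc' (by norm_num) hcont
    (show (0 : ℝ) ∈ Set.Icc _ _ from ⟨h2.le, h1.le⟩)
  have hne1 : s0 ≠ 1 / 10 := by rintro rfl; linarith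
  have hne2 : s0 ≠ 1 / 5 := by rintro rfl; linarith
  refine ⟨s0, lt_of_le_of_ne ha (Ne.symm hne1), lt_of_le_of_ne hb hne2, ?_, ?_⟩
  · rw [sextic_eq, h0, mul_zero]
  · intro s hs0 hs1 h
    rw [sextic_eq] at h
    rcases mul_eq_zero.1 h with h | h
    · left; linarith
    · right
      have h3 : 1 / 10 < s := by
        by_contra hc
        have := quintic_pos s hs0 (not_lt.1 hc)
        linarith
      have h4 : s < 1 / 5 := by
        by_contra hc
        have := quintic_neg s (not_lt.1 hc) hs1
        linarith
      rcases lt_trichotomy s s0 with h5 | h5 | h5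
      · have := quintic_anti s s0 h3.le h5 hb
        linarith
      · exact h5
      · have := quintic_anti s0 s ha h5 h4.le
        linarith

lemma inner_facts (A B C : E3) (d : ℝ) (hAB : ‖A - B‖ = d) (hAC : ‖A - C‖ = d)
    (hBC : ‖B - C‖ = d) :
    inner ℝ (A - B) (A - B) = d ^ 2 ∧ inner ℝ (A - C) (A - C) = d ^ 2 ∧
      inner ℝ (A - B) (A - C) = d ^ 2 / 2 := by
  have h1 : inner ℝ (A - B) (A - B) = d ^ 2 := by rw [real_inner_self_eq_norm_sq, hAB]
  have h2 : inner ℝ (A - C) (A - C) = d ^ 2 := by rw [real_inner_self_eq_norm_sq, hAC]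
  refine ⟨h1, h2, ?_⟩
  have h3 : inner ℝ (B - C) (B - C) = d ^ 2 := by rw [real_inner_self_eq_norm_sq, hBC]
  have h4 : B - C = (A - C) - (A - B) := by abel
  rw [h4] at h3
  generalize A - B = U at *
  generalize A - C = V at *
  rw [inner_sub_left, inner_sub_right, inner_sub_right, h1, h2, real_inner_comm U V] at h3
  linarith

lemma norm_sq_bary (A B C : E3) (d : ℝ) (hAB : ‖A - B‖ = d) (hAC : ‖A - C‖ = d)
    (hBC : ‖B - C‖ = d) (a b c : ℝ) (h : a + b + c = 1) :
    ‖a • A + b • B + c • C - A‖ ^ 2 = d ^ 2 * (b ^ 2 + b * c + c ^ 2) := by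
  obtain ⟨h1, h2, h3⟩ := inner_facts A B C d hAB hAC hBC
  have ha : a = 1 - b - c := by linarith
  have h4 : a • A + b • B + c • C - A = (-b) • (A - B) + (-c) • (A - C) := by
    rw [ha]; module
  rw [h4, ← real_inner_self_eq_norm_sq]
  simp only [inner_add_left, inner_add_right, real_inner_smul_left, real_inner_smul_right, h1, h2,
    h3, real_inner_comm (A - B) (A - C)]
  ring

lemma frame_facts (A B C : E3) (d : ℝ) (hAB : ‖A - B‖ = d) (hAC : ‖A - C‖ = d)
    (hBC : ‖B - C‖ = d) :
    inner ℝ ((2 : ℝ) • A - B - C) ((2 : ℝ) • A - B - C) = 3 * d ^ 2 ∧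
    inner ℝ (B - C) (B - C) = d ^ 2 ∧ inner ℝ ((2 : ℝ) • A - B - C) (B - C) = 0 := by
  obtain ⟨h1, h2, h3⟩ := inner_facts A B C d hAB hAC hBC
  have e1 : (2 : ℝ) • A - B - C = (A - B) + (A - C) := by module
  have e2 : B - C = (A - C) - (A - B) := by module
  rw [e1, e2]
  generalize A - B = U at *
  generalize A - C = V at *
  simp only [inner_add_left, inner_add_right, inner_sub_left, inner_sub_right, h1, h2,
    h3, real_inner_comm U V]
  refine ⟨by ring, by ring, by ring⟩

set_option maxHeartbeats 1000000 in
lemma axis_main (m : ℝ) (A B C : E3) (d : ℝ) (hd : 0 < d) (hAB : ‖A - B‖ = d)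
    (hAC : ‖A - C‖ = d) (hBC : ‖B - C‖ = d) (s : ℝ) (hs0 : 0 < s) (hs1 : s < 1)
    (hs : sextic s = 0) :
    (axisPt s A B C ≠ A ∧ axisPt s A B C ≠ B ∧ axisPt s A B C ≠ C) ∧
    fderiv ℝ (pot m A B C) (axisPt s A B C) = 0 ∧
    (s ≤ 1 / 5 → IsNondegenerateCrit (pot m A B C) (axisPt s A B C) ∧
      HasMorseIndex (pot m A B C) (axisPt s A B C) 2) ∧
    (s = 1 / 3 → IsNondegenerateCrit (pot m A B C) (axisPt s A B C) ∧
      HasMorseIndex (pot m A B C) (axisPt s A B C) 1) := by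
  obtain ⟨hee, hff, hef⟩ := frame_facts A B C d hAB hAC hBC
  set e : E3 := (2 : ℝ) • A - B - C with he_def
  set f : E3 := B - C with hf_def
  set x : E3 := axisPt s A B C with hx_def
  have hfe : inner ℝ f e = 0 := by rw [real_inner_comm]; exact hef
  have xA : x - A = (-((1 - s) / 2)) • e := by
    rw [hx_def, he_def, axisPt]; module
  have xB : x - B = (s / 2) • e + (-(1 / 2) : ℝ) • f := by
    rw [hx_def, he_def, hf_def, axisPt]; module
  have xC : x - C = (s / 2) • e + (1 / 2 : ℝ) • f := by
    rw [hx_def, he_def, hf_def, axisPt]; module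
  have nA : ‖x - A‖ ^ 2 = 3 / 4 * d ^ 2 * (1 - s) ^ 2 := by
    rw [← real_inner_self_eq_norm_sq, xA, real_inner_smul_left, real_inner_smul_right, hee]
    ring
  have nB : ‖x - B‖ ^ 2 = d ^ 2 * (1 + 3 * s ^ 2) / 4 := by
    rw [← real_inner_self_eq_norm_sq, xB]
    simp only [inner_add_left, inner_add_right, real_inner_smul_left, real_inner_smul_right, hee,
      hff, hef, hfe]
    ring
  have nC : ‖x - C‖ ^ 2 = d ^ 2 * (1 + 3 * s ^ 2) / 4 := by
    rw [← real_inner_self_eq_norm_sq, xC]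
    simp only [inner_add_left, inner_add_right, real_inner_smul_left, real_inner_smul_right, hee,
      hff, hef, hfe]
    ring
  have hs1' : 0 < 1 - s := by linarith
  have pA : 0 < ‖x - A‖ := by
    have : 0 < ‖x - A‖ ^ 2 := by rw [nA]; positivity
    exact lt_of_le_of_ne (norm_nonneg _) fun h => by rw [← h] at this; norm_num at this
  have pB : 0 < ‖x - B‖ := by
    have : 0 < ‖x - B‖ ^ 2 := by rw [nB]; positivity
    exact lt_of_le_of_ne (norm_nonneg _) fun h => by rw [← h] at this; norm_num at this
  have hCB : ‖x - C‖ = ‖x - B‖ :=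
    (sq_eq_sq₀ (norm_nonneg _) (norm_nonneg _)).1 (nC.trans nB.symm)
  have hxA : x ≠ A := sub_ne_zero.1 (norm_pos_iff.1 pA)
  have hxB : x ≠ B := sub_ne_zero.1 (norm_pos_iff.1 pB)
  have hxC : x ≠ C := sub_ne_zero.1 (norm_pos_iff.1 (hCB ▸ pB))
  set α := ‖x - A‖⁻¹ with hα
  set β := ‖x - B‖⁻¹ with hβ
  have α0 : 0 < α := inv_pos.2 pA
  have β0 : 0 < β := inv_pos.2 pB
  have α2 : α ^ 2 = 4 / (3 * d ^ 2 * (1 - s) ^ 2) := by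
    rw [hα, inv_pow, nA]; field_simp
  have β2 : β ^ 2 = 4 / (d ^ 2 * (1 + 3 * s ^ 2)) := by
    rw [hβ, inv_pow, nB]; field_simp
  have hsx : (1 + 3 * s ^ 2) ^ 3 = 108 * s ^ 2 * (1 - s) ^ 4 := by
    unfold sextic at hs; linarith
  have hw : α ^ 3 * (1 - s) = 2 * s * β ^ 3 := by
    refine (sq_eq_sq₀ (by positivity) (by positivity)).1 ?_
    have e1 : (α ^ 3 * (1 - s)) ^ 2 = (α ^ 2) ^ 3 * (1 - s) ^ 2 := by ring
    have e2 : (2 * s * β ^ 3) ^ 2 = 4 * s ^ 2 * (β ^ 2) ^ 3 := by ring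
    rw [e1, e2, α2, β2, div_pow, div_pow, mul_pow (d ^ 2), hsx]
    field_simp
    norm_num
  have hα3 : α ^ 3 = 2 * s / (1 - s) * β ^ 3 := by
    field_simp; linarith
  have hα5 : α ^ 5 = α ^ 3 * (4 / (3 * d ^ 2 * (1 - s) ^ 2)) := by rw [← α2]; ring
  have hβ5 : β ^ 5 = β ^ 3 * (4 / (d ^ 2 * (1 + 3 * s ^ 2))) := by rw [← β2]; ring
  refine ⟨⟨hxA, hxB, hxC⟩, ?_, ?_⟩
  · rw [fderiv_pot_eq_zero_iff m A B C x hxA hxB hxC, hCB, ← hα, ← hβ, xA, xB, xC]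
    have : (α ^ 3 • -((1 - s) / 2) • e + β ^ 3 • ((s / 2) • e + (-(1 / 2) : ℝ) • f)
       + β ^ 3 • ((s / 2) • e + (1 / 2 : ℝ) • f)) = (-(α ^ 3 * (1 - s) - 2 * s * β ^ 3) / 2) • e := by
      module
    rw [this, hw]
    simp
  have he0 : e ≠ 0 := by
    intro h
    rw [h, inner_zero_left] at hee
    have : 0 < 3 * d ^ 2 := by positivity
    linarith
  have hf0 : f ≠ 0 := by
    intro h
    rw [h, inner_zero_left] at hff
    have : 0 < d ^ 2 := by positivity
    linarith
  obtain ⟨n, hn0, hen, hfn⟩ := exists_normal e f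
  have hne : inner ℝ n e = 0 := by rw [real_inner_comm]; exact hen
  have hnf : inner ℝ n f = 0 := by rw [real_inner_comm]; exact hfn
  have hnn : 0 < inner ℝ n n := by
    rw [real_inner_self_eq_norm_sq]
    have := norm_pos_iff.2 hn0
    positivity
  have hL := fderiv2_pot m A B C x hxA hxB hxC
  rw [hCB, ← hα, ← hβ, xA, xB, xC] at hL
  simp only [inner_add_right, real_inner_smul_right] at hL
  set L := fderiv ℝ (fderiv ℝ (pot m A B C)) x with hLdef
  have Lef : L e f = 0 := by rw [hL]; simp only [hee, hff, hef, hfe]; ring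
  have Lfe : L f e = 0 := by rw [hL]; simp only [hee, hff, hef, hfe]; ring
  have Len : L e n = 0 := by rw [hL]; simp only [hen, hne, hnf, hfn]; ring
  have Lne : L n e = 0 := by rw [hL]; simp only [hen, hne, hnf, hfn]; ring
  have Lfn : L f n = 0 := by rw [hL]; simp only [hen, hne, hnf, hfn]; ring
  have Lnf : L n f = 0 := by rw [hL]; simp only [hen, hne, hnf, hfn]; ring
  have Lnn : L n n < 0 := by
    rw [hL]; simp only [hne, hnf]
    have : 0 < (α ^ 3 + 2 * β ^ 3) * inner ℝ n n := by positivity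
    linarith
  have Lee : L e e = 3 * d ^ 2 * β ^ 3 * (2 * s / (1 - s) + 9 * s ^ 2 / (1 + 3 * s ^ 2) - 1) := by
    rw [hL]; simp only [hee, hef]
    rw [hα5, hβ5, hα3]
    field_simp
    ring
  have Lff : L f f = 1 / 2 * d ^ 2 * β ^ 3 * (6 / (1 + 3 * s ^ 2) - 2 - 2 * s / (1 - s)) := by
    rw [hL]; simp only [hff, hfe]
    rw [hα5, hβ5, hα3]
    field_simp
    ring
  have hd2 : 0 < d ^ 2 * β ^ 3 := by positivity
  refine ⟨?_, ?_⟩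
  · intro hs5
    have k0 : s ^ 2 ≤ 1 / 25 := by
      have := pow_le_pow_left₀ hs0.le hs5 2
      norm_num at this ⊢
      exact this
    have k1 : 2 * s / (1 - s) ≤ 1 / 2 := by
      rw [div_le_iff₀ hs1']; linarith
    have k2 : 9 * s ^ 2 / (1 + 3 * s ^ 2) ≤ 9 / 25 := by
      rw [div_le_iff₀ (by positivity)]; linarith
    have k3 : 3 ≤ 6 / (1 + 3 * s ^ 2) := by
      rw [le_div_iff₀ (by positivity)]; linarith
    have Lee' : L e e < 0 := by
      rw [Lee]
      exact mul_neg_of_pos_of_neg (by positivity) (by linarith)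
    have Lff' : 0 < L f f := by
      rw [Lff]
      exact mul_pos (by positivity) (by linarith)
    exact ⟨nondeg_of_diag _ x e f n he0 hf0 hn0 hef hen hfn L rfl Lef Lfe Len Lne Lfn Lnf
      Lee'.ne Lff'.ne' Lnn.ne,
      morse2_of_diag _ x e f n he0 hf0 hn0 hen L rfl Len Lne Lee' Lff' Lnn⟩
  · intro hs3
    have Lee' : 0 < L e e := by
      rw [Lee, hs3]
      exact mul_pos (by positivity) (by norm_num)
    have Lff' : 0 < L f f := by
      rw [Lff, hs3]
      exact mul_pos (by positivity) (by norm_num)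
    exact ⟨nondeg_of_diag _ x e f n he0 hf0 hn0 hef hen hfn L rfl Lef Lfe Len Lne Lfn Lnf
      Lee'.ne' Lff'.ne' Lnn.ne,
      morse1_of_diag _ x e f n he0 hf0 hn0 hef L rfl Lef Lfe Lee' Lff' Lnn⟩

lemma forward_bary (m : ℝ) (A B C x : E3) (hA : x ≠ A) (hB : x ≠ B) (hC : x ≠ C)
    (h : fderiv ℝ (pot m A B C) x = 0) :
    ∃ a b c : ℝ, 0 < a ∧ 0 < b ∧ 0 < c ∧ a + b + c = 1 ∧ x = a • A + b • B + c • C ∧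
      a ^ 2 * (‖x - A‖ ^ 2) ^ 3 = b ^ 2 * (‖x - B‖ ^ 2) ^ 3 ∧
      a ^ 2 * (‖x - A‖ ^ 2) ^ 3 = c ^ 2 * (‖x - C‖ ^ 2) ^ 3 := by
  rw [fderiv_pot_eq_zero_iff m A B C x hA hB hC] at h
  have pA : 0 < ‖x - A‖ := norm_pos_iff.2 (sub_ne_zero.2 hA)
  have pB : 0 < ‖x - B‖ := norm_pos_iff.2 (sub_ne_zero.2 hB)
  have pC : 0 < ‖x - C‖ := norm_pos_iff.2 (sub_ne_zero.2 hC)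
  set r := ‖x - A‖
  set t := ‖x - B‖
  set w := ‖x - C‖
  have hW : 0 < r⁻¹ ^ 3 + t⁻¹ ^ 3 + w⁻¹ ^ 3 := by positivity
  set W := r⁻¹ ^ 3 + t⁻¹ ^ 3 + w⁻¹ ^ 3 with hWdef
  refine ⟨r⁻¹ ^ 3 / W, t⁻¹ ^ 3 / W, w⁻¹ ^ 3 / W, by positivity, by positivity, by positivity,
    ?_, ?_, ?_, ?_⟩
  · rw [← add_div, ← add_div]; exact div_self hW.ne'
  · have h1 : W • x = r⁻¹ ^ 3 • A + t⁻¹ ^ 3 • B + w⁻¹ ^ 3 • C := by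
      rw [← sub_eq_zero, ← h, hWdef]; module
    have h2 : x = W⁻¹ • (W • x) := by rw [smul_smul, inv_mul_cancel₀ hW.ne', one_smul]
    rw [h2, h1]
    module
  · field_simp
  · field_simp

lemma unimodal (q a b : ℝ) (ha : 0 < a) (hab : a < b) (hb : b ≤ 2 * q / 5) :
    a ^ 2 * (q - a) ^ 3 < b ^ 2 * (q - b) ^ 3 := by
  have hmono : StrictMonoOn (fun t : ℝ => t ^ 2 * (q - t) ^ 3) (Set.Icc 0 (2 * q / 5)) := by
    apply strictMonoOn_of_deriv_pos (convex_Icc _ _) (by fun_prop)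
    intro t ht
    rw [interior_Icc] at ht
    have hd : HasDerivAt (fun t : ℝ => t ^ 2 * (q - t) ^ 3) (t * (q - t) ^ 2 * (2 * q - 5 * t)) t := by
      have := ((hasDerivAt_id t).fun_pow 2).fun_mul (((hasDerivAt_id t).const_sub q).fun_pow 3)
      refine this.congr_deriv ?_
      simp
      ring
    rw [hd.deriv]
    have h1 := ht.1
    have h2 := ht.2
    have h3 : 0 < q - t := by linarith
    have h4 : 0 < 2 * q - 5 * t := by linarith
    positivity
  exact hmono ⟨ha.le, by linarith⟩ ⟨by linarith, hb⟩ hab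

lemma unimodal' (q a b : ℝ) (ha : 2 * q / 5 ≤ a) (ha0 : 0 < a) (hab : a < b) (hb : b < q) :
    b ^ 2 * (q - b) ^ 3 < a ^ 2 * (q - a) ^ 3 := by
  have hmono : StrictAntiOn (fun t : ℝ => t ^ 2 * (q - t) ^ 3) (Set.Icc (2 * q / 5) q) := by
    apply strictAntiOn_of_deriv_neg (convex_Icc _ _) (by fun_prop)
    intro t ht
    rw [interior_Icc] at ht
    have hd : HasDerivAt (fun t : ℝ => t ^ 2 * (q - t) ^ 3) (t * (q - t) ^ 2 * (2 * q - 5 * t)) t := by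
      have := ((hasDerivAt_id t).fun_pow 2).fun_mul (((hasDerivAt_id t).const_sub q).fun_pow 3)
      refine this.congr_deriv ?_
      simp
      ring
    rw [hd.deriv]
    have h1 := ht.1
    have h2 := ht.2
    have h3 : 0 < q - t := by linarith
    have h0 : 0 < t := by linarith
    exact mul_neg_of_pos_of_neg (by positivity) (by linarith)
  exact hmono ⟨ha, by linarith⟩ ⟨by linarith, hb.le⟩ hab

lemma two_eq (q a b c : ℝ) (ha : 0 < a) (hb : 0 < b) (hc : 0 < c) (ha' : a < q) (hb' : b < q)
    (hc' : c < q) (h1 : a ^ 2 * (q - a) ^ 3 = b ^ 2 * (q - b) ^ 3)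
    (h2 : a ^ 2 * (q - a) ^ 3 = c ^ 2 * (q - c) ^ 3) : b = c ∨ c = a ∨ a = b := by
  have lo : ∀ u v : ℝ, 0 < u → 0 < v → u ≤ 2 * q / 5 → v ≤ 2 * q / 5 →
      u ^ 2 * (q - u) ^ 3 = v ^ 2 * (q - v) ^ 3 → u = v := by
    intro u v hu hv hu' hv' h
    rcases lt_trichotomy u v with k | k | k
    · have := unimodal q u v hu k hv'
      linarith
    · exact k
    · have := unimodal q v u hv k hu'
      linarith
  have hi : ∀ u v : ℝ, 0 < u → 0 < v → 2 * q / 5 ≤ u → 2 * q / 5 ≤ v → u < q → v < q →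
      u ^ 2 * (q - u) ^ 3 = v ^ 2 * (q - v) ^ 3 → u = v := by
    intro u v hu hv hu' hv' huq hvq h
    rcases lt_trichotomy u v with k | k | k
    · have := unimodal' q u v hu' hu k hvq
      linarith
    · exact k
    · have := unimodal' q v u hv' hv k huq
      linarith
  have h3 := h1.symm.trans h2
  rcases le_total a (2 * q / 5) with ka | ka <;> rcases le_total b (2 * q / 5) with kb | kb <;>
    rcases le_total c (2 * q / 5) with kc | kc
  · exact Or.inl (lo b c hb hc kb kc h3)
  · exact Or.inr (Or.inr (lo a b ha hb ka kb h1))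
  · exact Or.inr (Or.inl (lo c a hc ha kc ka h2.symm))
  · exact Or.inl (hi b c hb hc kb kc hb' hc' h3)
  · exact Or.inl (lo b c hb hc kb kc h3)
  · exact Or.inr (Or.inl (hi c a hc ha kc ka hc' ha' h2.symm))
  · exact Or.inr (Or.inr (hi a b ha hb ka kb ha' hb' h1))
  · exact Or.inl (hi b c hb hc kb kc hb' hc' h3)

lemma sextic_of (a b q : ℝ) (hb : 0 < b) (h1 : a + b + b = 1)
    (hq : q = 1 - (a * b + b * b + b * a)) (h : a ^ 2 * (q - a) ^ 3 = b ^ 2 * (q - b) ^ 3) :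
    sextic a = 0 := by
  have ha : a = 1 - 2 * b := by linarith
  have h2 : b ^ 2 * sextic a = 0 := by
    have e1 : q - a = 3 * b ^ 2 := by rw [hq, ha]; ring
    have e2 : q - b = 1 - 3 * b + 3 * b ^ 2 := by rw [hq, ha]; ring
    rw [e1, e2, ha] at h
    unfold sextic
    rw [ha]
    linear_combination (-64) * h
  exact (mul_eq_zero.1 h2).resolve_left (by positivity)

lemma forward (m : ℝ) (A B C x : E3) (d : ℝ) (hd : 0 < d) (hAB : ‖A - B‖ = d)
    (hAC : ‖A - C‖ = d) (hBC : ‖B - C‖ = d) (hA : x ≠ A) (hB : x ≠ B) (hC : x ≠ C)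
    (h : fderiv ℝ (pot m A B C) x = 0) :
    ∃ s : ℝ, 0 < s ∧ s < 1 ∧ sextic s = 0 ∧
      (x = axisPt s A B C ∨ x = axisPt s B C A ∨ x = axisPt s C A B) := by
  obtain ⟨a, b, c, ha, hb, hc, h1, hx, hab, hac⟩ := forward_bary m A B C x hA hB hC h
  have hBA : ‖B - A‖ = d := by rw [norm_sub_rev]; exact hAB
  have hCA : ‖C - A‖ = d := by rw [norm_sub_rev]; exact hAC
  have hCB : ‖C - B‖ = d := by rw [norm_sub_rev]; exact hBC
  obtain ⟨q, hq⟩ : ∃ q, q = 1 - (a * b + b * c + c * a) := ⟨_, rfl⟩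
  have nA : ‖x - A‖ ^ 2 = d ^ 2 * (q - a) := by
    rw [hx, norm_sq_bary A B C d hAB hAC hBC a b c h1, hq]
    have : a = 1 - b - c := by linarith
    rw [this]; ring
  have nB : ‖x - B‖ ^ 2 = d ^ 2 * (q - b) := by
    have hx' : x = b • B + c • C + a • A := by rw [hx]; abel
    rw [hx', norm_sq_bary B C A d hBC hBA hCA b c a (by linarith), hq]
    have : a = 1 - b - c := by linarith
    rw [this]; ring
  have nC : ‖x - C‖ ^ 2 = d ^ 2 * (q - c) := by
    have hx' : x = c • C + a • A + b • B := by rw [hx]; abel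
    rw [hx', norm_sq_bary C A B d hCA hCB hAB c a b (by linarith), hq]
    have : a = 1 - b - c := by linarith
    rw [this]; ring
  have pos : ∀ (P : E3) (t : ℝ), x ≠ P → ‖x - P‖ ^ 2 = d ^ 2 * (q - t) → t < q := by
    intro P t hP ht
    have h1 : 0 < ‖x - P‖ := norm_pos_iff.2 (sub_ne_zero.2 hP)
    have h2 : 0 < d ^ 2 * (q - t) := by rw [← ht]; positivity
    have := (mul_pos_iff_of_pos_left (by positivity : 0 < d ^ 2)).1 h2
    linarith
  have qa := pos A a hA nA
  have qb := pos B b hB nB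
  have qc := pos C c hC nC
  rw [nA, nB] at hab
  rw [nA, nC] at hac
  have d6 : (d ^ 2) ^ 3 ≠ 0 := by positivity
  have hab' : a ^ 2 * (q - a) ^ 3 = b ^ 2 * (q - b) ^ 3 := by
    apply mul_left_cancel₀ d6
    linear_combination hab
  have hac' : a ^ 2 * (q - a) ^ 3 = c ^ 2 * (q - c) ^ 3 := by
    apply mul_left_cancel₀ d6
    linear_combination hac
  rcases two_eq q a b c ha hb hc qa qb qc hab' hac' with k | k | k
  · subst k
    refine ⟨a, ha, by linarith, sextic_of a b q hb h1 hq hab', Or.inl ?_⟩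
    rw [hx, axisPt, show b = (1 - a) / 2 by linarith]
    module
  · subst k
    refine ⟨b, hb, by linarith, sextic_of b c q hc (by linarith) (by rw [hq]; ring) hab'.symm,
      Or.inr (Or.inl ?_)⟩
    rw [hx, axisPt, show c = (1 - b) / 2 by linarith]
    module
  · subst k
    refine ⟨c, hc, by linarith, sextic_of c a q ha (by linarith) (by rw [hq]; ring) hac'.symm,
      Or.inr (Or.inr ?_)⟩
    rw [hx, axisPt, show a = (1 - c) / 2 by linarith]
    module

lemma axisPt_third (A B C : E3) : axisPt (1 / 3) A B C = (3 : ℝ)⁻¹ • (A + B + C) := by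
  rw [axisPt]; module

lemma axisPt_mem (s : ℝ) (A B C : E3) (S : Set E3) (hA : A ∈ S) (hB : B ∈ S) (hC : C ∈ S) :
    axisPt s A B C ∈ affineSpan ℝ S := by
  have hA' := subset_affineSpan ℝ S hA
  have hB' := subset_affineSpan ℝ S hB
  have hC' := subset_affineSpan ℝ S hC
  have h1 := AffineSubspace.smul_vsub_vadd_mem _ ((1 - s) / 2) hB' hA' hA'
  have h2 := AffineSubspace.smul_vsub_vadd_mem _ ((1 - s) / 2) hC' hA' h1
  convert h2 using 1
  simp only [vsub_eq_sub, vadd_eq_add, axisPt]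
  module

lemma axisPt_ne (A B C : E3) (s : ℝ) (hs : s < 1 / 3) (h : A ≠ B) :
    axisPt s A B C ≠ axisPt s B C A := by
  intro heq
  have h1 : ((3 * s - 1) / 2) • (A - B) = 0 := by
    have : ((3 * s - 1) / 2) • (A - B) = axisPt s A B C - axisPt s B C A := by
      simp only [axisPt]; module
    rw [this, heq, sub_self]
  rcases smul_eq_zero.1 h1 with h2 | h2
  · linarith
  · exact h (sub_eq_zero.1 h2)

lemma axisPt_ne_centroid (A B C : E3) (d : ℝ) (hd : 0 < d) (hAB : ‖A - B‖ = d)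
    (hAC : ‖A - C‖ = d) (hBC : ‖B - C‖ = d) (s : ℝ) (hs : s < 1 / 3) :
    axisPt s A B C ≠ (3 : ℝ)⁻¹ • (A + B + C) := by
  intro heq
  have h1 : ((1 - 3 * s) / 6) • ((2 : ℝ) • A - B - C) = 0 := by
    have : ((1 - 3 * s) / 6) • ((2 : ℝ) • A - B - C) =
        (3 : ℝ)⁻¹ • (A + B + C) - axisPt s A B C := by
      simp only [axisPt]; module
    rw [this, heq, sub_self]
  rcases smul_eq_zero.1 h1 with h2 | h2
  · linarith
  · have := (frame_facts A B C d hAB hAC hBC).1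
    rw [h2, inner_zero_left] at this
    have : 0 < 3 * d ^ 2 := by positivity
    linarith

/-- The potential of three unit charges at the vertices of an equilateral
triangle has exactly 4 critical points, all nondegenerate and in the plane of
the triangle: three of Morse index 2, and one of Morse index 1 at the
centroid. -/
theorem equilateral_triangle_critical_points
    (P : Fin 3 → EuclideanSpace ℝ (Fin 3)) (d : ℝ) (hd : 0 < d)
    (hPd : ∀ i j, i ≠ j → ‖P i - P j‖ = d)
    (m : ℝ) (hm : 0 ≤ m)
    (phi : EuclideanSpace ℝ (Fin 3) → ℝ)
    (hphi : phi = fun x => m + ∑ i, 1 / (2 * ‖x - P i‖)) :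
    let C := {x : EuclideanSpace ℝ (Fin 3) | x ∉ Set.range P ∧ fderiv ℝ phi x = 0}
    let c := (3 : ℝ)⁻¹ • (P 0 + P 1 + P 2)
    C.ncard = 4 ∧
    (∀ x ∈ C, IsNondegenerateCrit phi x ∧ x ∈ affineSpan ℝ (Set.range P)) ∧
    c ∈ C ∧ HasMorseIndex phi c 1 ∧
    (∀ x ∈ C, x ≠ c → HasMorseIndex phi x 2) := by
  intro C c
  obtain ⟨s0, hs1, hs2, hs0, huniq⟩ := exists_root
  have h01 : ‖P 0 - P 1‖ = d := hPd 0 1 (by decide)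
  have h02 : ‖P 0 - P 2‖ = d := hPd 0 2 (by decide)
  have h12 : ‖P 1 - P 2‖ = d := hPd 1 2 (by decide)
  have h10 : ‖P 1 - P 0‖ = d := hPd 1 0 (by decide)
  have h20 : ‖P 2 - P 0‖ = d := hPd 2 0 (by decide)
  have h21 : ‖P 2 - P 1‖ = d := hPd 2 1 (by decide)
  have p0 : phi = pot m (P 0) (P 1) (P 2) := by
    rw [hphi]; funext x; simp only [pot, Fin.sum_univ_three]
  have p1 : phi = pot m (P 1) (P 2) (P 0) := by
    rw [hphi]; funext x; simp only [pot, Fin.sum_univ_three]; ring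
  have p2 : phi = pot m (P 2) (P 0) (P 1) := by
    rw [hphi]; funext x; simp only [pot, Fin.sum_univ_three]; ring
  have hrange : ∀ x : E3, x ∉ Set.range P ↔ x ≠ P 0 ∧ x ≠ P 1 ∧ x ≠ P 2 := by
    intro x
    rw [Set.mem_range, not_exists, Fin.forall_fin_succ, Fin.forall_fin_two]
    exact ⟨fun h => ⟨fun k => h.1 k.symm, fun k => h.2.1 k.symm, fun k => h.2.2 k.symm⟩,
      fun h => ⟨fun k => h.1 k.symm, fun k => h.2.1 k.symm, fun k => h.2.2 k.symm⟩⟩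
  have hc0 : axisPt (1 / 3) (P 0) (P 1) (P 2) = c := axisPt_third _ _ _
  have hc1 : axisPt (1 / 3) (P 1) (P 2) (P 0) = c := by
    rw [axisPt_third]; congr 1; abel
  have hc2 : axisPt (1 / 3) (P 2) (P 0) (P 1) = c := by
    rw [axisPt_third]; congr 1; abel
  have hthird : sextic (1 / 3) = 0 := by unfold sextic; norm_num
  have mc := axis_main m (P 0) (P 1) (P 2) d hd h01 h02 h12 (1 / 3) (by norm_num) (by norm_num)
    hthird
  have m0 := axis_main m (P 0) (P 1) (P 2) d hd h01 h02 h12 s0 (by linarith) (by linarith) hs0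
  have m1 := axis_main m (P 1) (P 2) (P 0) d hd h12 h10 h20 s0 (by linarith) (by linarith) hs0
  have m2 := axis_main m (P 2) (P 0) (P 1) d hd h20 h21 h01 s0 (by linarith) (by linarith) hs0
  rw [hc0, ← p0] at mc
  rw [← p0] at m0
  rw [← p1] at m1
  rw [← p2] at m2
  have memc : c ∈ C := ⟨(hrange c).2 mc.1, mc.2.1⟩
  have mem0 : axisPt s0 (P 0) (P 1) (P 2) ∈ C := ⟨(hrange _).2 m0.1, m0.2.1⟩
  have mem1 : axisPt s0 (P 1) (P 2) (P 0) ∈ C :=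
    ⟨(hrange _).2 ⟨m1.1.2.2, m1.1.1, m1.1.2.1⟩, m1.2.1⟩
  have mem2 : axisPt s0 (P 2) (P 0) (P 1) ∈ C :=
    ⟨(hrange _).2 ⟨m2.1.2.1, m2.1.2.2, m2.1.1⟩, m2.2.1⟩
  have cases4 : ∀ x ∈ C, x = c ∨ x = axisPt s0 (P 0) (P 1) (P 2) ∨
      x = axisPt s0 (P 1) (P 2) (P 0) ∨ x = axisPt s0 (P 2) (P 0) (P 1) := by
    rintro x ⟨hx, hx'⟩
    obtain ⟨k0, k1, k2⟩ := (hrange x).1 hx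
    rw [p0] at hx'
    obtain ⟨s, hs, hs', hsx, hh⟩ := forward m (P 0) (P 1) (P 2) x d hd h01 h02 h12 k0 k1 k2 hx'
    rcases huniq s hs hs' hsx with rfl | rfl
    · left
      rw [hc0, hc1, hc2] at hh
      tauto
    · exact Or.inr hh
  have hCset : C = {c, axisPt s0 (P 0) (P 1) (P 2), axisPt s0 (P 1) (P 2) (P 0),
      axisPt s0 (P 2) (P 0) (P 1)} := by
    ext x
    simp only [Set.mem_insert_iff, Set.mem_singleton_iff]
    constructor
    · exact cases4 x
    · rintro (rfl | rfl | rfl | rfl) <;> assumption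
  have ne_of : ∀ A B : E3, ‖A - B‖ = d → A ≠ B := by
    rintro A B h rfl
    rw [sub_self, norm_zero] at h
    linarith
  have hlt : s0 < 1 / 3 := by linarith
  have e0 : axisPt s0 (P 0) (P 1) (P 2) ≠ c := axisPt_ne_centroid _ _ _ d hd h01 h02 h12 s0 hlt
  have e1 : axisPt s0 (P 1) (P 2) (P 0) ≠ c := by
    have := axisPt_ne_centroid _ _ _ d hd h12 h10 h20 s0 hlt
    rwa [← axisPt_third, hc1] at this
  have e2 : axisPt s0 (P 2) (P 0) (P 1) ≠ c := by
    have := axisPt_ne_centroid _ _ _ d hd h20 h21 h01 s0 hlt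
    rwa [← axisPt_third, hc2] at this
  have e01 := axisPt_ne (P 0) (P 1) (P 2) s0 hlt (ne_of _ _ h01)
  have e12 := axisPt_ne (P 1) (P 2) (P 0) s0 hlt (ne_of _ _ h12)
  have e20 := axisPt_ne (P 2) (P 0) (P 1) s0 hlt (ne_of _ _ h20)
  have r0 : P 0 ∈ Set.range P := ⟨0, rfl⟩
  have r1 : P 1 ∈ Set.range P := ⟨1, rfl⟩
  have r2 : P 2 ∈ Set.range P := ⟨2, rfl⟩
  refine ⟨?_, ?_, memc, (mc.2.2.2 rfl).2, ?_⟩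
  · rw [hCset, Set.ncard_eq_toFinset_card']
    classical
    simp only [Set.toFinset_insert, Set.toFinset_singleton]
    rw [Finset.card_insert_of_notMem, Finset.card_insert_of_notMem, Finset.card_insert_of_notMem,
      Finset.card_singleton]
    · simpa using e12
    · simpa using ⟨e01, e20.symm⟩
    · simpa using ⟨e0.symm, e1.symm, e2.symm⟩
  · intro x hx
    rcases cases4 x hx with rfl | rfl | rfl | rfl
    · refine ⟨(mc.2.2.2 rfl).1, ?_⟩
      rw [← hc0]
      exact axisPt_mem _ _ _ _ _ r0 r1 r2
    · exact ⟨(m0.2.2.1 hs2.le).1, axisPt_mem _ _ _ _ _ r0 r1 r2⟩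
    · exact ⟨(m1.2.2.1 hs2.le).1, axisPt_mem _ _ _ _ _ r1 r2 r0⟩
    · exact ⟨(m2.2.2.1 hs2.le).1, axisPt_mem _ _ _ _ _ r2 r0 r1⟩
  · intro x hx hxc
    rcases cases4 x hx with h | rfl | rfl | rfl
    · exact absurd h hxc
    · exact (m0.2.2.1 hs2.le).2
    · exact (m1.2.2.1 hs2.le).2
    · exact (m2.2.2.1 hs2.le).2
end
end
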